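/- arXiv:1904.07676 — 6 statements merged into one kernel-verified Lean document; each statement's English description precedes it below -/
import Mathlib

section
/- For every y : K×V̄ → {0,1}, strong duality holds for Problem 3: sup_{λ ≥ 0} D(λ) = E_t*(y), where E_t*(y) is the optimal value (infimum) of Problem 3 and D is its partial dual function; the supremum is attained by some λ* ≥ 0; and moreover, if (t*, e*) is an optimal solution of Problem 3, then (t*, e*) attains the infimum defining D(λ*), i.e., L(t*, e*, λ*) = D(λ*) = E_t*(y). -/
noncomputable section

open Finset

variable {K Vb S : Type*}

/-- `φ(t,u) = t·log₂(1 + u/t)` for `t > 0`, and `φ(0,u) = 0`. -/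
def phi (t u : ℝ) : ℝ := if t = 0 then 0 else t * Real.logb 2 (1 + u / t)

/-- Feasibility for Problem 3 (time/energy allocation for a given binary `y`):
`t, e ≥ 0`, the per-state time budget `Σ_v t_{s,v} ≤ T`, and the rate constraints
`(B/T)·Σ_s q_s·φ(t_{s,v}, e_{s,v}h_{s,k}/n₀) ≥ y_{k,v}·R`. -/
def P3Feas [Fintype K] [Fintype Vb] [Fintype S]
    (q : S → ℝ) (ch : S → K → ℝ) (B T R n0 : ℝ)
    (y : K → Vb → ℝ) (t e : S → Vb → ℝ) : Prop :=
  (∀ s v, 0 ≤ t s v) ∧ (∀ s v, 0 ≤ e s v) ∧ (∀ s, ∑ v, t s v ≤ T) ∧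
  (∀ k v, y k v * R ≤ B / T * ∑ s, q s * phi (t s v) (e s v * ch s k / n0))

/-- The optimal value `E_t*(y)` of Problem 3: the infimum of the average transmission
energy `Σ_s q_s Σ_v e_{s,v}` over the feasible set. -/
def Etstar [Fintype K] [Fintype Vb] [Fintype S]
    (q : S → ℝ) (ch : S → K → ℝ) (B T R n0 : ℝ) (y : K → Vb → ℝ) : ℝ :=
  sInf {z : ℝ | ∃ t e : S → Vb → ℝ,
    P3Feas q ch B T R n0 y t e ∧ z = ∑ s, q s * ∑ v, e s v}

/-- The partial Lagrangian `L(t,e,λ)` of Problem 3, relaxing the rate constraints. -/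
def Lag [Fintype K] [Fintype Vb] [Fintype S]
    (q : S → ℝ) (ch : S → K → ℝ) (B T R n0 : ℝ)
    (y : K → Vb → ℝ) (t e : S → Vb → ℝ) (lam : K → Vb → ℝ) : ℝ :=
  (∑ s, q s * ∑ v, e s v) -
    ∑ k, ∑ v, lam k v *
      (B / T * ∑ s, q s * phi (t s v) (e s v * ch s k / n0) - y k v * R)

/-- The partial dual function `D(λ)` of Problem 3: the infimum of the Lagrangian over
`t, e ≥ 0` with the per-state time budgets. -/
def Dfun [Fintype K] [Fintype Vb] [Fintype S]
    (q : S → ℝ) (ch : S → K → ℝ) (B T R n0 : ℝ)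
    (y : K → Vb → ℝ) (lam : K → Vb → ℝ) : ℝ :=
  sInf {z : ℝ | ∃ t e : S → Vb → ℝ,
    (∀ s v, 0 ≤ t s v) ∧ (∀ s v, 0 ≤ e s v) ∧ (∀ s, ∑ v, t s v ≤ T) ∧
    z = Lag q ch B T R n0 y t e lam}

lemma phi_mul_mul {c : ℝ} (t u : ℝ) : phi (c * t) (c * u) = c * phi t u := by
  rcases eq_or_ne c 0 with rfl | hc
  · simp [phi]
  · rcases eq_or_ne t 0 with rfl | ht
    · simp [phi]
    · simp [phi, hc, ht, mul_div_mul_left, mul_assoc]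

lemma phi_mono_right {t u w : ℝ} (ht : 0 ≤ t) (hu : 0 ≤ u) (huw : u ≤ w) : phi t u ≤ phi t w := by
  rcases ht.eq_or_lt with rfl | ht
  · simp [phi]
  · simp only [phi, ht.ne', if_false]
    have h : 0 < 1 + u / t := by positivity
    gcongr
    norm_num

lemma phi_nonneg {t u : ℝ} (ht : 0 ≤ t) (hu : 0 ≤ u) : 0 ≤ phi t u := by
  have h := phi_mono_right ht le_rfl hu
  simpa [phi] using h

lemma phi_add_phi_le {t₁ t₂ u₁ u₂ : ℝ} (ht₁ : 0 ≤ t₁) (ht₂ : 0 ≤ t₂) (hu₁ : 0 ≤ u₁)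
    (hu₂ : 0 ≤ u₂) : phi t₁ u₁ + phi t₂ u₂ ≤ phi (t₁ + t₂) (u₁ + u₂) := by
  rcases ht₁.eq_or_lt with rfl | ht₁
  · have h := phi_mono_right ht₂ hu₂ (le_add_of_nonneg_left hu₁)
    simpa [phi] using h
  rcases ht₂.eq_or_lt with rfl | ht₂
  · have h := phi_mono_right ht₁.le hu₁ (le_add_of_nonneg_right hu₂)
    simpa [phi] using h
  have ht : 0 < t₁ + t₂ := by positivity
  have h₁ : 0 < 1 + u₁ / t₁ := by positivity
  have h₂ : 0 < 1 + u₂ / t₂ := by positivity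
  have key := strictConcaveOn_log_Ioi.concaveOn.2 (Set.mem_Ioi.2 h₁) (Set.mem_Ioi.2 h₂)
    (show 0 ≤ t₁ / (t₁ + t₂) by positivity) (show 0 ≤ t₂ / (t₁ + t₂) by positivity)
    (by field_simp)
  have harg : t₁ / (t₁ + t₂) * (1 + u₁ / t₁) + t₂ / (t₁ + t₂) * (1 + u₂ / t₂)
      = 1 + (u₁ + u₂) / (t₁ + t₂) := by
    field_simp
    ring
  simp only [smul_eq_mul, harg] at key
  have hlog : 0 < Real.log 2 := Real.log_pos one_lt_two
  simp only [phi, ht.ne', ht₁.ne', ht₂.ne', if_false, Real.logb]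
  have hscaled := mul_le_mul_of_nonneg_left key ht.le
  have hlhs : (t₁ + t₂) * (t₁ / (t₁ + t₂) * Real.log (1 + u₁ / t₁) +
      t₂ / (t₁ + t₂) * Real.log (1 + u₂ / t₂)) =
      t₁ * Real.log (1 + u₁ / t₁) + t₂ * Real.log (1 + u₂ / t₂) := by
    field_simp
  rw [hlhs] at hscaled
  simp only [← mul_div_assoc, ← add_div]
  gcongr

lemma concaveOn_phi : ConcaveOn ℝ {p : ℝ × ℝ | 0 ≤ p.1 ∧ 0 ≤ p.2} fun p ↦ phi p.1 p.2 := by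
  refine ⟨?_, ?_⟩
  · rintro ⟨t₁, u₁⟩ ⟨ht₁, hu₁⟩ ⟨t₂, u₂⟩ ⟨ht₂, hu₂⟩ a b ha hb -
    simp only at ht₁ hu₁ ht₂ hu₂
    constructor <;> simp <;> positivity
  · rintro ⟨t₁, u₁⟩ ⟨ht₁, hu₁⟩ ⟨t₂, u₂⟩ ⟨ht₂, hu₂⟩ a b ha hb -
    simp only at ht₁ hu₁ ht₂ hu₂
    simpa [phi_mul_mul] using phi_add_phi_le (mul_nonneg ha ht₁) (mul_nonneg hb ht₂)
      (mul_nonneg ha hu₁) (mul_nonneg hb hu₂)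

open Filter in
lemma tendsto_phi_atTop {t : ℝ} (ht : 0 < t) : Tendsto (phi t) atTop atTop := by
  have h : phi t = fun u ↦ t * Real.logb 2 (1 + u / t) := by
    ext u
    simp [phi, ht.ne']
  rw [h]
  exact ((Real.tendsto_logb_atTop one_lt_two).comp
    (tendsto_atTop_add_const_left _ _ (tendsto_id.atTop_div_const ht))).const_mul_atTop ht

/-- Existence of Lagrange multipliers for a convex program satisfying Slater's condition. -/
lemma exists_lagrange_multiplier {E ι : Type*} [AddCommGroup E] [Module ℝ E] [Fintype ι]
    {C : Set E} {f : E → ℝ} {g : ι → E → ℝ} (hf : ConvexOn ℝ C f)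
    (hg : ∀ i, ConcaveOn ℝ C (g i)) {m : ℝ}
    (hm : ∀ x ∈ C, (∀ i, 0 ≤ g i x) → m ≤ f x) (hslater : ∃ x ∈ C, ∀ i, 0 < g i x) :
    ∃ lam : ι → ℝ, (∀ i, 0 ≤ lam i) ∧ ∀ x ∈ C, m ≤ f x - ∑ i, lam i * g i x := by
  classical
  set A : Set ((ι → ℝ) × ℝ) := {p | ∃ x ∈ C, (∀ i, p.1 i < g i x) ∧ f x < p.2} with hA
  have hAconv : Convex ℝ A := by
    rintro ⟨u, r⟩ ⟨x, hx, hu, hr⟩ ⟨w, l⟩ ⟨z, hz, hw, hl⟩ a b ha hb hab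
    have hlt : ∀ {p q p' q' : ℝ}, p < p' → q < q' → a * p + b * q < a * p' + b * q' := by
      intro p q p' q' h h'
      rcases ha.eq_or_lt with rfl | ha
      · have : b = 1 := by linarith
        subst this
        linarith
      · nlinarith [mul_lt_mul_of_pos_left h ha, mul_le_mul_of_nonneg_left h'.le hb]
    refine ⟨a • x + b • z, hf.1 hx hz ha hb hab, fun i ↦ ?_, ?_⟩
    · exact (hlt (hu i) (hw i)).trans_le ((hg i).2 hx hz ha hb hab)
    · exact (hf.2 hx hz ha hb hab).trans_lt (hlt hr hl)
  have hAopen : IsOpen A := by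
    have : A = ⋃ x ∈ C, {p : (ι → ℝ) × ℝ | (∀ i, p.1 i < g i x) ∧ f x < p.2} := by
      ext p
      simp only [hA, Set.mem_iUnion, Set.mem_ofPred_eq, exists_prop]
    rw [this]
    refine isOpen_biUnion fun x _ ↦ ?_
    simp only [Set.ofPred_and, Set.ofPred_forall]
    refine (isOpen_iInter_of_finite fun i ↦ ?_).inter ?_
    · exact isOpen_lt (by fun_prop) (by fun_prop)
    · exact isOpen_lt (by fun_prop) (by fun_prop)
  have hnot : ((0, m) : (ι → ℝ) × ℝ) ∉ A := by
    rintro ⟨x, hx, hu, hr⟩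
    exact absurd (hm x hx fun i ↦ (hu i).le) (not_le.2 hr)
  obtain ⟨F, hF⟩ := geometric_hahn_banach_open_point hAconv hAopen hnot
  set μ : ι → ℝ := fun i ↦ F (Pi.single i 1, 0) with hμ
  set α : ℝ := F (0, 1) with hα
  have hFeq : ∀ u r, F (u, r) = ∑ i, μ i * u i + α * r := by
    intro u r
    have hdec : ((u, r) : (ι → ℝ) × ℝ) =
        ∑ i, u i • ((Pi.single i 1, 0) : (ι → ℝ) × ℝ) + r • (0, 1) := by
      ext j
      · simp [Prod.fst_sum, Finset.sum_apply, Pi.single_apply]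
      · simp [Prod.snd_sum]
    rw [hdec]
    simp only [map_add, map_sum, map_smul, smul_eq_mul, hμ, hα, mul_comm]
  have hsep : ∀ x ∈ C, ∀ (u : ι → ℝ) (r : ℝ), (∀ i, u i < g i x) → f x < r →
      ∑ i, μ i * u i + α * r < α * m := by
    intro x hx u r hu hr
    have h := hF (u, r) ⟨x, hx, hu, hr⟩
    rw [hFeq, hFeq] at h
    simpa using h
  obtain ⟨x₀, hx₀, hpos⟩ := hslater
  have hα_neg : α < 0 := by
    have hmx := hm x₀ hx₀ fun i ↦ (hpos i).le
    have h := hsep x₀ hx₀ 0 (f x₀ + 1) hpos (by linarith)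
    simp only [Pi.zero_apply, mul_zero, Finset.sum_const_zero, zero_add] at h
    nlinarith
  have hμ_nonneg : ∀ i, 0 ≤ μ i := by
    intro i
    by_contra! hi
    set M : ℝ := |α * (f x₀ + 1) - α * m| / (-μ i) with hM
    have hMnn : 0 ≤ M := by
      have : 0 < -μ i := by linarith
      positivity
    have h := hsep x₀ hx₀ (Pi.single i (-M)) (f x₀ + 1) (fun j ↦ ?_) (by linarith)
    · have hsum : ∑ j, μ j * (Pi.single i (-M) : ι → ℝ) j = μ i * (-M) := by
        simp [Pi.single_apply]
      have hval : μ i * (-M) = |α * (f x₀ + 1) - α * m| := by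
        rw [hM, mul_neg, ← neg_mul, mul_div_cancel₀ _ (neg_pos.2 hi).ne']
      rw [hsum, hval] at h
      linarith [neg_abs_le (α * (f x₀ + 1) - α * m)]
    · rcases eq_or_ne j i with rfl | hj
      · simp only [Pi.single_eq_same]
        linarith [hpos j]
      · simpa [hj] using hpos j
  refine ⟨fun i ↦ μ i / (-α), fun i ↦ div_nonneg (hμ_nonneg i) (by linarith), fun x hx ↦ ?_⟩
  have hle : ∑ i, μ i * g i x + α * f x ≤ α * m := by
    have hcpos : 0 < ∑ i, μ i - α := by
      have := Finset.sum_nonneg fun i (_ : i ∈ Finset.univ) ↦ hμ_nonneg i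
      linarith
    refine le_of_forall_pos_le_add fun ε hε ↦ ?_
    set δ : ℝ := ε / (∑ i, μ i - α) with hδ
    have hδpos : 0 < δ := by positivity
    have h := hsep x hx (fun i ↦ g i x - δ) (f x + δ) (fun i ↦ by linarith) (by linarith)
    have hεδ : ε = (∑ i, μ i) * δ - α * δ := by
      rw [← sub_mul, hδ]
      field_simp
    simp only [mul_sub, Finset.sum_sub_distrib, ← Finset.sum_mul] at h
    linarith
  have hsum : ∑ i, μ i / (-α) * g i x = (∑ i, μ i * g i x) / (-α) := by
    rw [Finset.sum_div]
    exact Finset.sum_congr rfl fun i _ ↦ by ring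
  rw [hsum, le_sub_iff_add_le, ← le_sub_iff_add_le', div_le_iff₀ (by linarith)]
  linarith

/-- The allocations meeting the sign constraints and the per-state time budgets. -/
def budgetSet (S Vb : Type*) [Fintype Vb] (T : ℝ) : Set ((S → Vb → ℝ) × (S → Vb → ℝ)) :=
  {p | (∀ s v, 0 ≤ p.1 s v) ∧ (∀ s v, 0 ≤ p.2 s v) ∧ ∀ s, ∑ v, p.1 s v ≤ T}

lemma convex_budgetSet (S Vb : Type*) [Fintype Vb] (T : ℝ) : Convex ℝ (budgetSet S Vb T) := by
  rintro ⟨t, e⟩ ⟨ht, he, hT⟩ ⟨t', e'⟩ ⟨ht', he', hT'⟩ a b ha hb hab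
  simp only at ht he hT ht' he' hT'
  refine ⟨fun s v ↦ ?_, fun s v ↦ ?_, fun s ↦ ?_⟩
  · exact add_nonneg (mul_nonneg ha (ht s v)) (mul_nonneg hb (ht' s v))
  · exact add_nonneg (mul_nonneg ha (he s v)) (mul_nonneg hb (he' s v))
  · simp only [Prod.smul_mk, Prod.mk_add_mk, Pi.add_apply, Pi.smul_apply, smul_eq_mul,
      Finset.sum_add_distrib, ← Finset.mul_sum]
    calc a * ∑ v, t s v + b * ∑ v, t' s v ≤ a * T + b * T := by gcongr <;> apply_assumption
      _ = T := by rw [← add_mul, hab, one_mul]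

lemma concaveOn_rate_slack [Fintype Vb] [Fintype S] {q : S → ℝ} (hq : ∀ s, 0 ≤ q s)
    {ch : S → K → ℝ} (hch : ∀ s k, 0 ≤ ch s k) {B T n0 : ℝ} (hB : 0 ≤ B) (hT : 0 ≤ T)
    (hn0 : 0 ≤ n0) (c : ℝ) (k : K) (v : Vb) :
    ConcaveOn ℝ (budgetSet S Vb T) fun p ↦
      B / T * ∑ s, q s * phi (p.1 s v) (p.2 s v * ch s k / n0) - c := by
  refine ⟨convex_budgetSet S Vb T, ?_⟩
  rintro ⟨t, e⟩ ⟨ht, he, -⟩ ⟨t', e'⟩ ⟨ht', he', -⟩ a b ha hb hab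
  simp only at ht he ht' he'
  simp only [Prod.smul_mk, Prod.mk_add_mk, Pi.add_apply, Pi.smul_apply, smul_eq_mul]
  have hscale : ∀ s, 0 ≤ ch s k / n0 := fun s ↦ div_nonneg (hch s k) hn0
  have hsum : a * ∑ s, q s * phi (t s v) (e s v * ch s k / n0) +
      b * ∑ s, q s * phi (t' s v) (e' s v * ch s k / n0) ≤
      ∑ s, q s * phi (a * t s v + b * t' s v) ((a * e s v + b * e' s v) * ch s k / n0) := by
    rw [Finset.mul_sum, Finset.mul_sum, ← Finset.sum_add_distrib]
    refine Finset.sum_le_sum fun s _ ↦ ?_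
    have h := concaveOn_phi.2
      (x := (t s v, e s v * (ch s k / n0))) ⟨ht s v, mul_nonneg (he s v) (hscale s)⟩
      (y := (t' s v, e' s v * (ch s k / n0))) ⟨ht' s v, mul_nonneg (he' s v) (hscale s)⟩
      ha hb hab
    simp only [Prod.smul_mk, Prod.mk_add_mk, smul_eq_mul] at h
    have harg : a * (e s v * (ch s k / n0)) + b * (e' s v * (ch s k / n0)) =
        (a * e s v + b * e' s v) * (ch s k / n0) := by ring
    rw [harg] at h
    simp only [mul_div_assoc]
    linarith [mul_le_mul_of_nonneg_left h (hq s)]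
  have h := mul_le_mul_of_nonneg_left hsum (div_nonneg hB hT)
  have hc : a * c + b * c = c := by rw [← add_mul, hab, one_mul]
  linarith

open Filter in
/-- Slater's condition: any prescribed rates can be strictly exceeded within the time budgets. -/
lemma exists_budgetSet_rate_gt [Finite K] [Fintype Vb] [Fintype S] [Nonempty Vb] [Nonempty S]
    {q : S → ℝ} (hq : ∀ s, 0 < q s) {ch : S → K → ℝ} (hch : ∀ s k, 0 < ch s k)
    {B T n0 : ℝ} (hB : 0 < B) (hT : 0 < T) (hn0 : 0 < n0) (c : K → Vb → ℝ) :
    ∃ p ∈ budgetSet S Vb T, ∀ k v,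
      c k v < B / T * ∑ s, q s * phi (p.1 s v) (p.2 s v * ch s k / n0) := by
  set τ : ℝ := T / Fintype.card Vb with hτ
  have hτpos : 0 < τ := by positivity
  obtain ⟨s₀⟩ := ‹Nonempty S›
  have hev : ∀ᶠ x : ℝ in atTop, ∀ k v, c k v < B / T * (q s₀ * phi τ (x * ch s₀ k / n0)) := by
    simp only [eventually_all]
    intro k v
    have hlim : Tendsto (fun x ↦ B / T * (q s₀ * phi τ (x * ch s₀ k / n0))) atTop atTop :=
      (((tendsto_phi_atTop hτpos).comp ((tendsto_id.atTop_mul_const (hch s₀ k)).atTop_div_const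
        hn0)).const_mul_atTop (hq s₀)).const_mul_atTop (by positivity)
    exact hlim.eventually_gt_atTop _
  obtain ⟨x, hx, hx0⟩ := (hev.and (eventually_ge_atTop 0)).exists
  refine ⟨(fun _ _ ↦ τ, fun _ _ ↦ x), ⟨fun _ _ ↦ hτpos.le, fun _ _ ↦ hx0, fun s ↦ ?_⟩,
    fun k v ↦ (hx k v).trans_le ?_⟩
  · simp only [Finset.sum_const, Finset.card_univ, nsmul_eq_mul, hτ]
    exact (mul_div_cancel₀ T (by positivity)).le
  · gcongr
    exact Finset.single_le_sum (f := fun s ↦ q s * phi τ (x * ch s k / n0))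
      (fun s _ ↦ mul_nonneg (hq s).le (phi_nonneg hτpos.le
        (div_nonneg (mul_nonneg hx0 (hch s k).le) hn0.le))) (Finset.mem_univ s₀)

section WeakDuality

variable [Fintype K] [Fintype Vb] [Fintype S] {q : S → ℝ} {ch : S → K → ℝ} {B T R n0 : ℝ}
  {y : K → Vb → ℝ}

lemma Lag_le_cost {t e : S → Vb → ℝ} {lam : K → Vb → ℝ} (hlam : ∀ k v, 0 ≤ lam k v)
    (h : P3Feas q ch B T R n0 y t e) :
    Lag q ch B T R n0 y t e lam ≤ ∑ s, q s * ∑ v, e s v := by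
  refine sub_le_self _ (Finset.sum_nonneg fun k _ ↦ Finset.sum_nonneg fun v _ ↦ ?_)
  exact mul_nonneg (hlam k v) (sub_nonneg.2 (h.2.2.2 k v))

lemma P3Feas.cost_nonneg (hq : ∀ s, 0 ≤ q s) {t e : S → Vb → ℝ}
    (h : P3Feas q ch B T R n0 y t e) : 0 ≤ ∑ s, q s * ∑ v, e s v :=
  Finset.sum_nonneg fun s _ ↦ mul_nonneg (hq s) (Finset.sum_nonneg fun v _ ↦ h.2.1 s v)

lemma Etstar_le_cost (hq : ∀ s, 0 ≤ q s) {t e : S → Vb → ℝ}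
    (h : P3Feas q ch B T R n0 y t e) :
    Etstar q ch B T R n0 y ≤ ∑ s, q s * ∑ v, e s v := by
  refine csInf_le ⟨0, ?_⟩ ⟨t, e, h, rfl⟩
  rintro _ ⟨t, e, h, rfl⟩
  exact h.cost_nonneg hq

/-- Weak duality; when the Lagrangian is unbounded below, `Dfun` takes the value `0`. -/
lemma Dfun_le_Etstar (hq : ∀ s, 0 ≤ q s) (hfeas : ∃ t e, P3Feas q ch B T R n0 y t e)
    {lam : K → Vb → ℝ} (hlam : ∀ k v, 0 ≤ lam k v) :
    Dfun q ch B T R n0 y lam ≤ Etstar q ch B T R n0 y := by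
  obtain ⟨t₀, e₀, h₀⟩ := hfeas
  refine le_csInf ⟨_, t₀, e₀, h₀, rfl⟩ ?_
  rintro _ ⟨t, e, h, rfl⟩
  rw [Dfun]
  by_cases hbdd : BddBelow {z : ℝ | ∃ t e : S → Vb → ℝ,
    (∀ s v, 0 ≤ t s v) ∧ (∀ s v, 0 ≤ e s v) ∧ (∀ s, ∑ v, t s v ≤ T) ∧
    z = Lag q ch B T R n0 y t e lam}
  · exact (csInf_le hbdd ⟨t, e, h.1, h.2.1, h.2.2.1, rfl⟩).trans (Lag_le_cost hlam h)
  · rw [Real.sInf_of_not_bddBelow hbdd]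
    exact h.cost_nonneg hq

end WeakDuality

/-- strong duality for Problem 3.  For every binary `y`,
`sup_{λ ≥ 0} D(λ) = E_t*(y)`, the supremum is attained by some `λ* ≥ 0`, and every
optimal solution `(t*, e*)` of Problem 3 attains the infimum defining `D(λ*)`. -/
theorem strong_duality_problem3
    [Fintype K] [Fintype Vb] [Fintype S] [Nonempty K] [Nonempty Vb] [Nonempty S]
    (q : S → ℝ) (hq : ∀ s, 0 < q s) (hqsum : ∑ s, q s = 1)
    (ch : S → K → ℝ) (hch : ∀ s k, 0 < ch s k)
    (B T R n0 : ℝ) (hB : 0 < B) (hT : 0 < T) (hR : 0 < R) (hn0 : 0 < n0)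
    (y : K → Vb → ℝ) (hy : ∀ k v, y k v = 0 ∨ y k v = 1) :
    sSup {z : ℝ | ∃ lam : K → Vb → ℝ, (∀ k v, 0 ≤ lam k v) ∧
        z = Dfun q ch B T R n0 y lam} = Etstar q ch B T R n0 y ∧
    ∃ lam : K → Vb → ℝ, (∀ k v, 0 ≤ lam k v) ∧
      Dfun q ch B T R n0 y lam = Etstar q ch B T R n0 y ∧
      ∀ t e : S → Vb → ℝ, P3Feas q ch B T R n0 y t e →
        (∑ s, q s * ∑ v, e s v) = Etstar q ch B T R n0 y →
        Lag q ch B T R n0 y t e lam = Dfun q ch B T R n0 y lam := by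
  have hq0 : ∀ s, 0 ≤ q s := fun s ↦ (hq s).le
  obtain ⟨p₀, hp₀, hrate⟩ := exists_budgetSet_rate_gt hq hch hB hT hn0 fun k v ↦ y k v * R
  have hfeas : ∃ t e, P3Feas q ch B T R n0 y t e :=
    ⟨p₀.1, p₀.2, hp₀.1, hp₀.2.1, hp₀.2.2, fun k v ↦ (hrate k v).le⟩
  have hcost : ConvexOn ℝ (budgetSet S Vb T) fun p ↦ ∑ s, q s * ∑ v, p.2 s v := by
    refine ⟨convex_budgetSet S Vb T, fun p _ p' _ a b _ _ _ ↦ le_of_eq ?_⟩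
    simp only [Prod.snd_add, Prod.smul_snd, Pi.add_apply, Pi.smul_apply, smul_eq_mul,
      Finset.sum_add_distrib, mul_add, Finset.mul_sum, mul_left_comm]
  obtain ⟨mult, hmult, hle⟩ := exists_lagrange_multiplier hcost
    (fun i : K × Vb ↦ concaveOn_rate_slack hq0 (fun s k ↦ (hch s k).le) hB.le hT.le hn0.le
      (y i.1 i.2 * R) i.1 i.2) (m := Etstar q ch B T R n0 y)
    (fun p hp hslack ↦ Etstar_le_cost hq0
      ⟨hp.1, hp.2.1, hp.2.2, fun k v ↦ sub_nonneg.1 (hslack (k, v))⟩)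
    ⟨p₀, hp₀, fun i ↦ sub_pos.2 (hrate i.1 i.2)⟩
  set lam : K → Vb → ℝ := fun k v ↦ mult (k, v) with hlam_def
  have hlam : ∀ k v, 0 ≤ lam k v := fun k v ↦ hmult (k, v)
  have hLag : ∀ t e : S → Vb → ℝ, (∀ s v, 0 ≤ t s v) → (∀ s v, 0 ≤ e s v) →
      (∀ s, ∑ v, t s v ≤ T) → Etstar q ch B T R n0 y ≤ Lag q ch B T R n0 y t e lam := by
    intro t e ht he hbudget
    have h := hle (t, e) ⟨ht, he, hbudget⟩
    rwa [Fintype.sum_prod_type] at h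
  have hD : Dfun q ch B T R n0 y lam = Etstar q ch B T R n0 y := by
    refine le_antisymm (Dfun_le_Etstar hq0 hfeas hlam) ?_
    refine le_csInf ⟨_, p₀.1, p₀.2, hp₀.1, hp₀.2.1, hp₀.2.2, rfl⟩ ?_
    rintro _ ⟨t, e, ht, he, hbudget, rfl⟩
    exact hLag t e ht he hbudget
  refine ⟨IsGreatest.csSup_eq ⟨⟨lam, hlam, hD.symm⟩, ?_⟩, lam, hlam, hD, fun t e h hopt ↦ ?_⟩
  · rintro _ ⟨lam', hlam', rfl⟩
    exact Dfun_le_Etstar hq0 hfeas hlam'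
  · rw [hD]
    exact le_antisymm ((Lag_le_cost hlam h).trans_eq hopt) (hLag t e h.1 h.2.1 h.2.2.1)
end
end

section
/- For any feasible point (x, y, t, p) of Problem 1, the point (x', y, t, p) with x'_v = max_{k∈K} y_{k,v} for every v ∈ V̄ is also feasible for Problem 1 and satisfies E(x', y, t, p) ≤ E(x, y, t, p); if moreover E_b > 0 and x_v = 1 > max_{k∈K} y_{k,v} for some v ∈ V̄ ∖ V, the inequality is strict. Consequently, if Problem 1 admits an optimal solution, it admits an optimal solution (x*, y*, t*, p*) with x*_v = max_{k∈K} y*_{k,v} for all v ∈ V̄, and when E_b > 0 every optimal solution satisfies x*_v = max_{k∈K} y*_{k,v} for all v ∈ V̄ ∖ V. -/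
noncomputable section

open Finset

/-- The view grid `V̄ = {1 + j/Q : j = 0,…,(V−1)Q} ⊆ ℝ`. -/
def Vbar (V Q : ℕ) : Finset ℝ :=
  (Finset.range ((V - 1) * Q + 1)).image (fun j : ℕ => 1 + (j : ℝ) / Q)

/-- The original views `V = {1,…,V} ⊆ V̄`. -/
def Vorig (V : ℕ) : Finset ℝ :=
  (Finset.range V).image (fun i : ℕ => (i : ℝ) + 1)

/-- The quality grid `{1, 1 + 1/Q, …, V−1}`. -/
def Dset (V Q : ℕ) : Finset ℝ :=
  (Finset.range ((V - 2) * Q + 1)).image (fun j : ℕ => 1 + (j : ℝ) / Q)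

variable {K S : Type*}

/-- Feasibility for Problem 1 (average weighted sum energy minimization):
binary view transmission variables `x`, binary view utilization variables `y`
satisfying the view-selection constraints for requests `r` and qualities `Δ`,
`x ≥ y`, nonnegative time and power allocations `t, p` with per-state time budgets,
and the successful transmission (rate) constraints. -/
def P1Feasible (V Q : ℕ) [Fintype K] [Fintype S]
    (q : S → ℝ) (ch : S → K → ℝ) (B T R n0 : ℝ) (r Δ : K → ℝ)
    (x : ℝ → ℝ) (y : K → ℝ → ℝ) (t p : S → ℝ → ℝ) : Prop :=
  (∀ v ∈ Vbar V Q, x v = 0 ∨ x v = 1) ∧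
  (∀ k : K, ∀ v ∈ Vbar V Q, y k v = 0 ∨ y k v = 1) ∧
  (∀ k : K, y k (r k) +
      ∑ v ∈ (Vbar V Q).filter (fun v => r k < v ∧ v ≤ r k + Δ k), y k v = 1) ∧
  (∀ k : K, y k (r k) +
      ∑ v ∈ (Vbar V Q).filter (fun v => r k - Δ k ≤ v ∧ v < r k), y k v = 1) ∧
  (∀ k : K, ∀ v ∈ Vbar V Q, Δ k < |v - r k| → y k v = 0) ∧
  (∀ k : K, ∀ v ∈ Vbar V Q, y k v ≤ x v) ∧
  (∀ s : S, ∀ v ∈ Vbar V Q, 0 ≤ t s v) ∧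
  (∀ s : S, ∑ v ∈ Vbar V Q, t s v ≤ T) ∧
  (∀ s : S, ∀ v ∈ Vbar V Q, 0 ≤ p s v) ∧
  (∀ k : K, ∀ v ∈ Vbar V Q,
    y k v * R ≤ B / T * ∑ s : S, q s * (t s v * Real.logb 2 (1 + p s v * ch s k / n0)))

/-- The objective of Problem 1: the average weighted sum energy consumption
`E(x,y,t,p)`. -/
def Eobj (V Q : ℕ) [Fintype K] [Fintype S]
    (q : S → ℝ) (Eb : ℝ) (Eu : K → ℝ) (β : ℝ) (r : K → ℝ)
    (x : ℝ → ℝ) (y : K → ℝ → ℝ) (t p : S → ℝ → ℝ) : ℝ :=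
  (∑ s : S, q s * ∑ v ∈ Vbar V Q, t s v * p s v)
    + Eb * ∑ v ∈ Vbar V Q \ Vorig V, x v
    + β * ∑ k : K, (1 - y k (r k)) * Eu k

/-- An optimal solution of Problem 1: feasible and of minimal objective value among
all feasible points. -/
def P1Optimal (V Q : ℕ) [Fintype K] [Fintype S]
    (q : S → ℝ) (ch : S → K → ℝ) (B T R n0 : ℝ) (Eb : ℝ) (Eu : K → ℝ) (β : ℝ)
    (r Δ : K → ℝ) (x : ℝ → ℝ) (y : K → ℝ → ℝ) (t p : S → ℝ → ℝ) : Prop :=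
  P1Feasible V Q q ch B T R n0 r Δ x y t p ∧
  ∀ (x' : ℝ → ℝ) (y' : K → ℝ → ℝ) (t' p' : S → ℝ → ℝ),
    P1Feasible V Q q ch B T R n0 r Δ x' y' t' p' →
    Eobj V Q q Eb Eu β r x y t p ≤ Eobj V Q q Eb Eu β r x' y' t' p'

/-- The smallest transmission vector dominating the utilization variables. -/
def utilized [Fintype K] [Nonempty K] (y : K → ℝ → ℝ) (v : ℝ) : ℝ :=
  Finset.univ.sup' Finset.univ_nonempty (fun k : K => y k v)

lemma le_utilized [Fintype K] [Nonempty K] (y : K → ℝ → ℝ) (k : K) (v : ℝ) :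
    y k v ≤ utilized y v :=
  Finset.le_sup' (fun k : K => y k v) (Finset.mem_univ k)

lemma utilized_mem_binary [Fintype K] [Nonempty K] {y : K → ℝ → ℝ} {v : ℝ}
    (h : ∀ k, y k v = 0 ∨ y k v = 1) : utilized y v = 0 ∨ utilized y v = 1 := by
  obtain ⟨k, -, hk⟩ :=
    Finset.exists_mem_eq_sup' Finset.univ_nonempty (fun k : K => y k v)
  exact (show utilized y v = y k v from hk) ▸ h k

lemma P1Feasible.utilized_le {V Q : ℕ} [Fintype K] [Fintype S] [Nonempty K]
    {q : S → ℝ} {ch : S → K → ℝ} {B T R n0 : ℝ} {r Δ : K → ℝ}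
    {x : ℝ → ℝ} {y : K → ℝ → ℝ} {t p : S → ℝ → ℝ}
    (h : P1Feasible V Q q ch B T R n0 r Δ x y t p) {v : ℝ} (hv : v ∈ Vbar V Q) :
    utilized y v ≤ x v := by
  obtain ⟨-, -, -, -, -, hyx, -⟩ := h
  exact Finset.sup'_le _ _ fun k _ => hyx k v hv

lemma P1Feasible.utilized {V Q : ℕ} [Fintype K] [Fintype S] [Nonempty K]
    {q : S → ℝ} {ch : S → K → ℝ} {B T R n0 : ℝ} {r Δ : K → ℝ}
    {x : ℝ → ℝ} {y : K → ℝ → ℝ} {t p : S → ℝ → ℝ}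
    (h : P1Feasible V Q q ch B T R n0 r Δ x y t p) :
    P1Feasible V Q q ch B T R n0 r Δ (utilized y) y t p := by
  obtain ⟨-, hy, hright, hleft, hfar, -, hrest⟩ := h
  exact ⟨fun v hv => utilized_mem_binary fun k => hy k v hv, hy, hright, hleft, hfar,
    fun k v _ => le_utilized y k v, hrest⟩

lemma Eobj_mono {V Q : ℕ} [Fintype K] [Fintype S] (q : S → ℝ) {Eb : ℝ} (hEb : 0 ≤ Eb)
    (Eu : K → ℝ) (β : ℝ) (r : K → ℝ) {x x' : ℝ → ℝ} (y : K → ℝ → ℝ) (t p : S → ℝ → ℝ)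
    (h : ∀ v ∈ Vbar V Q \ Vorig V, x' v ≤ x v) :
    Eobj V Q q Eb Eu β r x' y t p ≤ Eobj V Q q Eb Eu β r x y t p := by
  have := mul_le_mul_of_nonneg_left (Finset.sum_le_sum h) hEb
  unfold Eobj
  linarith

lemma Eobj_strict_mono {V Q : ℕ} [Fintype K] [Fintype S] (q : S → ℝ) {Eb : ℝ} (hEb : 0 < Eb)
    (Eu : K → ℝ) (β : ℝ) (r : K → ℝ) {x x' : ℝ → ℝ} (y : K → ℝ → ℝ) (t p : S → ℝ → ℝ)
    (h : ∀ v ∈ Vbar V Q \ Vorig V, x' v ≤ x v)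
    (hlt : ∃ v ∈ Vbar V Q \ Vorig V, x' v < x v) :
    Eobj V Q q Eb Eu β r x' y t p < Eobj V Q q Eb Eu β r x y t p := by
  have := mul_lt_mul_of_pos_left (Finset.sum_lt_sum h hlt) hEb
  unfold Eobj
  linarith

/-- replacing `x` by `x'_v = max_{k∈K} y_{k,v}` preserves feasibility for
Problem 1 and does not increase the objective; the decrease is strict when `E_b > 0` and
`x_v = 1 > max_k y_{k,v}` for some synthesized view `v ∈ V̄ ∖ V`.  Consequently, if
Problem 1 admits an optimal solution, it admits one with `x_v = max_k y_{k,v}` for all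
`v ∈ V̄`, and when `E_b > 0` every optimal solution satisfies this on `V̄ ∖ V`. -/
theorem transmit_only_utilized_views (V Q : ℕ) (hV : 2 ≤ V) (hQ : 2 ≤ Q)
    [Fintype K] [Fintype S] [Nonempty K] [Nonempty S]
    (q : S → ℝ) (hq : ∀ s, 0 < q s) (hqsum : ∑ s, q s = 1)
    (ch : S → K → ℝ) (hch : ∀ s k, 0 < ch s k)
    (B T R n0 : ℝ) (hB : 0 < B) (hT : 0 < T) (hR : 0 < R) (hn0 : 0 < n0)
    (Eb : ℝ) (hEb : 0 ≤ Eb) (Eu : K → ℝ) (hEu : ∀ k, 0 ≤ Eu k)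
    (β : ℝ) (hβ : 1 ≤ β)
    (r : K → ℝ) (hr : ∀ k, r k ∈ Vbar V Q)
    (Δ : K → ℝ) (hΔ : ∀ k, Δ k ∈ Dset V Q) :
    (∀ (x : ℝ → ℝ) (y : K → ℝ → ℝ) (t p : S → ℝ → ℝ),
      P1Feasible V Q q ch B T R n0 r Δ x y t p →
      (P1Feasible V Q q ch B T R n0 r Δ
          (fun v => Finset.univ.sup' Finset.univ_nonempty (fun k : K => y k v)) y t p ∧
       Eobj V Q q Eb Eu β r
          (fun v => Finset.univ.sup' Finset.univ_nonempty (fun k : K => y k v)) y t p ≤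
         Eobj V Q q Eb Eu β r x y t p) ∧
      (0 < Eb →
        (∃ v ∈ Vbar V Q \ Vorig V, x v = 1 ∧
            Finset.univ.sup' Finset.univ_nonempty (fun k : K => y k v) < 1) →
        Eobj V Q q Eb Eu β r
            (fun v => Finset.univ.sup' Finset.univ_nonempty (fun k : K => y k v)) y t p <
          Eobj V Q q Eb Eu β r x y t p)) ∧
    ((∃ (x : ℝ → ℝ) (y : K → ℝ → ℝ) (t p : S → ℝ → ℝ),
        P1Optimal V Q q ch B T R n0 Eb Eu β r Δ x y t p) →
      ∃ (x : ℝ → ℝ) (y : K → ℝ → ℝ) (t p : S → ℝ → ℝ),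
        P1Optimal V Q q ch B T R n0 Eb Eu β r Δ x y t p ∧
        ∀ v ∈ Vbar V Q,
          x v = Finset.univ.sup' Finset.univ_nonempty (fun k : K => y k v)) ∧
    (0 < Eb →
      ∀ (x : ℝ → ℝ) (y : K → ℝ → ℝ) (t p : S → ℝ → ℝ),
        P1Optimal V Q q ch B T R n0 Eb Eu β r Δ x y t p →
        ∀ v ∈ Vbar V Q \ Vorig V,
          x v = Finset.univ.sup' Finset.univ_nonempty (fun k : K => y k v)) := by
  have hle : ∀ {x : ℝ → ℝ} {y : K → ℝ → ℝ} {t p : S → ℝ → ℝ},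
      P1Feasible V Q q ch B T R n0 r Δ x y t p →
      ∀ v ∈ Vbar V Q \ Vorig V, utilized y v ≤ x v :=
    fun h v hv => h.utilized_le (Finset.mem_sdiff.1 hv).1
  refine ⟨fun x y t p h => ⟨⟨h.utilized, Eobj_mono q hEb Eu β r y t p (hle h)⟩, ?_⟩, ?_, ?_⟩
  · rintro hpos ⟨v, hv, hx, hlt⟩
    exact Eobj_strict_mono q hpos Eu β r y t p (hle h) ⟨v, hv, hx ▸ hlt⟩
  · rintro ⟨x, y, t, p, h, hmin⟩
    exact ⟨utilized y, y, t, p,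
      ⟨h.utilized, fun x' y' t' p' h' =>
        (Eobj_mono q hEb Eu β r y t p (hle h)).trans (hmin x' y' t' p' h')⟩,
      fun _ _ => rfl⟩
  · rintro hpos x y t p ⟨h, hmin⟩ v hv
    by_contra hne
    have hlt : utilized y v < x v := lt_of_le_of_ne (hle h v hv) (Ne.symm hne)
    exact (Eobj_strict_mono q hpos Eu β r y t p (hle h) ⟨v, hv, hlt⟩).not_ge
      (hmin _ _ _ _ h.utilized)
end
end

section
/- Suppose all users have the same quality level Δ_k = Δ for some Δ ∈ {1, 1+1/Q, …, V−1}, |K| ≥ 2, and β·E_{u,k} ≥ E_b for every k ∈ K. If Problem 1 admits an optimal solution, then it admits an optimal solution (x*, y*, t*, p*) such that y*_{k,v} = 0 for every k ∈ K and every view v ∈ V̄ ∖ (∪_{k∈K} U_k). -/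
noncomputable section

open Finset

variable {K S : Type*}

open Classical in
/-- The set `U_{a,b}` of views that may be utilized by a user requesting `ra` in the
presence of a user requesting `rb`, for the common quality `Δ`:
Case 1 (`V̄⁺_{r_min} ∩ V̄⁻_{r_max} = ∅`): `{r_a}`;
Case 2 (`V̄⁺_{r_min} ∩ V̄⁻_{r_max} ≠ ∅` and `r_max ∉ V̄⁺_{r_min}`):
  `{r_a, r_max − Δ, r_min + Δ} ∪ (V̄⁺_{r_min} ∩ V̄⁻_{r_max} ∩ V)`;
Case 3 (`r_max ∈ V̄⁺_{r_min}`): `{r_a, r_b, r_max − Δ, r_min + Δ}`. -/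
def Uab (V Q : ℕ) (Δ : ℝ) (ra rb : ℝ) : Set ℝ :=
  let rmax := max ra rb
  let rmin := min ra rb
  let Vp : Set ℝ := {x | x ∈ Vbar V Q ∧ rmin < x ∧ x ≤ rmin + Δ}
  let Vm : Set ℝ := {x | x ∈ Vbar V Q ∧ rmax - Δ ≤ x ∧ x < rmax}
  if Vp ∩ Vm = ∅ then {ra}
  else if rmax ∉ Vp then
    {ra, rmax - Δ, rmin + Δ} ∪ (Vp ∩ Vm ∩ {x | x ∈ Vorig V})
  else {ra, rb, rmax - Δ, rmin + Δ}

/-- `U_k = ∪_{i ∈ K, i ≠ k} U_{k,i}`: the set of views that may be utilized by user `k`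
considering the presence of all other users. -/
def Uset (V Q : ℕ) [Fintype K] (Δ : ℝ) (r : K → ℝ) (k : K) : Set ℝ :=
  ⋃ (i : K) (_ : i ≠ k), Uab V Q Δ (r k) (r i)

/-- The power of the allocation merging `(t₁, p₁)` and `(t₂, p₂)` at equal energy. -/
def mergedPower (t₁ p₁ t₂ p₂ : ℝ) : ℝ := (t₁ * p₁ + t₂ * p₂) / (t₁ + t₂)

lemma add_mul_mergedPower {t₁ t₂ : ℝ} (p₁ p₂ : ℝ) (h₁ : 0 ≤ t₁) (h₂ : 0 ≤ t₂) :
    (t₁ + t₂) * mergedPower t₁ p₁ t₂ p₂ = t₁ * p₁ + t₂ * p₂ := by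
  unfold mergedPower
  rcases eq_or_ne (t₁ + t₂) 0 with h | h
  · have e₁ : t₁ = 0 := by linarith
    have e₂ : t₂ = 0 := by linarith
    simp [e₁, e₂]
  · field_simp

lemma mergedPower_nonneg {t₁ p₁ t₂ p₂ : ℝ} (h₁ : 0 ≤ t₁) (h₂ : 0 ≤ t₂) (hp₁ : 0 ≤ p₁)
    (hp₂ : 0 ≤ p₂) : 0 ≤ mergedPower t₁ p₁ t₂ p₂ := by
  unfold mergedPower
  positivity

/-- Merging two allocations does not decrease the total rate, by concavity of `log`. -/
lemma rate_add_le_rate_merged {t₁ p₁ t₂ p₂ g n : ℝ} (h₁ : 0 ≤ t₁) (h₂ : 0 ≤ t₂) (hp₁ : 0 ≤ p₁)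
    (hp₂ : 0 ≤ p₂) (hg : 0 ≤ g) (hn : 0 ≤ n) :
    t₁ * Real.logb 2 (1 + p₁ * g / n) + t₂ * Real.logb 2 (1 + p₂ * g / n) ≤
      (t₁ + t₂) * Real.logb 2 (1 + mergedPower t₁ p₁ t₂ p₂ * g / n) := by
  rcases eq_or_ne (t₁ + t₂) 0 with h | h
  · have e₁ : t₁ = 0 := by linarith
    have e₂ : t₂ = 0 := by linarith
    simp [e₁, e₂]
  have ht : 0 < t₁ + t₂ := lt_of_le_of_ne (by linarith) h.symm
  have m₁ : 1 + p₁ * g / n ∈ Set.Ioi (0 : ℝ) := by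
    have : 0 ≤ p₁ * g / n := by positivity
    simp only [Set.mem_Ioi]; linarith
  have m₂ : 1 + p₂ * g / n ∈ Set.Ioi (0 : ℝ) := by
    have : 0 ≤ p₂ * g / n := by positivity
    simp only [Set.mem_Ioi]; linarith
  have hc := strictConcaveOn_log_Ioi.concaveOn.2 m₁ m₂ 
    (show 0 ≤ t₁ / (t₁ + t₂) by positivity) (show 0 ≤ t₂ / (t₁ + t₂) by positivity)
    (by field_simp)
  have harg : t₁ / (t₁ + t₂) * (1 + p₁ * g / n) + t₂ / (t₁ + t₂) * (1 + p₂ * g / n)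
      = 1 + mergedPower t₁ p₁ t₂ p₂ * g / n := by
    have : t₁ / (t₁ + t₂) + t₂ / (t₁ + t₂) = 1 := by field_simp
    calc _ = (t₁ / (t₁ + t₂) + t₂ / (t₁ + t₂))
          + (t₁ * p₁ + t₂ * p₂) / (t₁ + t₂) * g / n := by ring
      _ = _ := by rw [this, mergedPower]
  simp only [smul_eq_mul] at hc
  rw [harg] at hc
  have hl2 : 0 < Real.log 2 := Real.log_pos one_lt_two
  have hc' := mul_le_mul_of_nonneg_left hc ht.le
  have e : (t₁ + t₂) * (t₁ / (t₁ + t₂) * Real.log (1 + p₁ * g / n)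
      + t₂ / (t₁ + t₂) * Real.log (1 + p₂ * g / n))
      = t₁ * Real.log (1 + p₁ * g / n) + t₂ * Real.log (1 + p₂ * g / n) := by
    field_simp
  rw [e] at hc'
  simp only [Real.logb]
  rw [← mul_div_assoc, ← mul_div_assoc, ← mul_div_assoc, ← add_div]
  exact div_le_div_of_nonneg_right hc' hl2.le

lemma rate_nonneg {t p g n : ℝ} (ht : 0 ≤ t) (hp : 0 ≤ p) (hg : 0 ≤ g) (hn : 0 ≤ n) :
    0 ≤ t * Real.logb 2 (1 + p * g / n) :=
  mul_nonneg ht (Real.logb_nonneg one_lt_two (le_add_of_nonneg_right (by positivity)))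

lemma le_one_of_binary {a : ℝ} (h : a = 0 ∨ a = 1) : a ≤ 1 := by
  rcases h with h | h <;> norm_num [h]

lemma nonneg_of_binary {a : ℝ} (h : a = 0 ∨ a = 1) : 0 ≤ a := by
  rcases h with h | h <;> norm_num [h]

/-- Moving the mass of a function at `v` onto `w` preserves its sum. -/
lemma sum_merge {α : Type*} [DecidableEq α] {A : Finset α} {v w : α} (hv : v ∈ A) (hw : w ∈ A)
    (hvw : v ≠ w) {f f' : α → ℝ} (h0 : f' v = 0) (h1 : f' w = f v + f w)
    (h2 : ∀ u, u ≠ v → u ≠ w → f' u = f u) : ∑ u ∈ A, f' u = ∑ u ∈ A, f u := by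
  have hw' : w ∈ A.erase v := mem_erase.2 ⟨hvw.symm, hw⟩
  rw [← add_sum_erase A f' hv, ← add_sum_erase A f hv, ← add_sum_erase _ f' hw',
    ← add_sum_erase _ f hw', h0, h1]
  have : ∑ u ∈ (A.erase v).erase w, f' u = ∑ u ∈ (A.erase v).erase w, f u := by
    refine sum_congr rfl fun u hu => ?_
    simp only [mem_erase] at hu
    exact h2 u hu.2.1 hu.1
  rw [this]; ring

lemma add_le_sum_of_nonneg {α : Type*} [DecidableEq α] {A : Finset α} {v w : α} (hv : v ∈ A)
    (hw : w ∈ A) (hvw : v ≠ w) {f : α → ℝ} (hf : ∀ u ∈ A, 0 ≤ f u) :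
    f v + f w ≤ ∑ u ∈ A, f u := by
  rw [← sum_pair hvw]
  exact sum_le_sum_of_subset_of_nonneg (by simp [insert_subset_iff, hv, hw]) fun u hu _ => hf u hu

open Classical in
/-- The utilization of a user requesting `ρ` after replacing the view `v` by `w`; if `w` is the
requested view, the user needs no other view. -/
def replaceUse (v w ρ : ℝ) (f : ℝ → ℝ) (u : ℝ) : ℝ :=
  if f v = 1 then
    if w = ρ then (if u = ρ then 1 else 0)
    else if u = v then 0 else if u = w then 1 else f u
  else f u

section replaceUse

variable {G : Finset ℝ} {v w ρ Δ : ℝ} {f : ℝ → ℝ}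

/-- `w` is an admissible replacement of `v` for a user requesting `ρ`. -/
def Replaceable (Δ v w ρ : ℝ) : Prop :=
  (ρ < v ∧ ρ ≤ w ∧ w ≤ ρ + Δ) ∨ (v < ρ ∧ ρ - Δ ≤ w ∧ w ≤ ρ)

/-- The view-selection constraints of a user requesting `ρ` with quality `Δ`. -/
def Selects (G : Finset ℝ) (ρ Δ : ℝ) (f : ℝ → ℝ) : Prop :=
  (∀ u ∈ G, f u = 0 ∨ f u = 1) ∧
  (f ρ + ∑ u ∈ G.filter (fun u => ρ < u ∧ u ≤ ρ + Δ), f u = 1) ∧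
  (f ρ + ∑ u ∈ G.filter (fun u => ρ - Δ ≤ u ∧ u < ρ), f u = 1) ∧
  (∀ u ∈ G, Δ < |u - ρ| → f u = 0)

lemma Selects.abs_sub_le (hf : Selects G ρ Δ f) (hv : v ∈ G) (h1 : f v = 1) : |v - ρ| ≤ Δ := by
  by_contra h
  have := hf.2.2.2 v hv (not_le.1 h)
  linarith

lemma Selects.request_eq_zero (hf : Selects G ρ Δ f) (hv : v ∈ G) (h1 : f v = 1)
    (hne : v ≠ ρ) : f ρ = 0 ∨ ρ ∉ G := by
  by_cases hρ : ρ ∈ G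
  swap
  · exact Or.inr hρ
  have habs := abs_le.1 (hf.abs_sub_le hv h1)
  have hρ0 := nonneg_of_binary (hf.1 ρ hρ)
  refine Or.inl (le_antisymm ?_ hρ0)
  rcases lt_or_gt_of_ne hne with h | h
  · have := single_le_sum (f := f) (s := G.filter (fun u => ρ - Δ ≤ u ∧ u < ρ))
      (fun u hu => nonneg_of_binary (hf.1 u (mem_filter.1 hu).1))
      (mem_filter.2 ⟨hv, by linarith, h⟩)
    linarith [hf.2.2.1]
  · have := single_le_sum (f := f) (s := G.filter (fun u => ρ < u ∧ u ≤ ρ + Δ))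
      (fun u hu => nonneg_of_binary (hf.1 u (mem_filter.1 hu).1))
      (mem_filter.2 ⟨hv, h, by linarith⟩)
    linarith [hf.2.1]

lemma Selects.replacement_eq_zero (hf : Selects G ρ Δ f) (hρ : ρ ∈ G) (hv : v ∈ G) (hw : w ∈ G)
    (hvw : v ≠ w) (h1 : f v = 1) (hrep : Replaceable Δ v w ρ) : f w = 0 := by
  have habs := abs_le.1 (hf.abs_sub_le hv h1)
  have hρ0 := nonneg_of_binary (hf.1 ρ hρ)
  rcases eq_or_ne w ρ with rfl | hwρ
  · exact (hf.request_eq_zero hv h1 hvw).resolve_right (not_not.2 hρ)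
  refine le_antisymm ?_ (nonneg_of_binary (hf.1 w hw))
  rcases hrep with ⟨h, h', h''⟩ | ⟨h, h', h''⟩
  · have := add_le_sum_of_nonneg (f := f) (A := G.filter (fun u => ρ < u ∧ u ≤ ρ + Δ))
      (mem_filter.2 ⟨hv, h, by linarith⟩)
      (mem_filter.2 ⟨hw, lt_of_le_of_ne h' hwρ.symm, h''⟩) hvw
      (fun u hu => nonneg_of_binary (hf.1 u (mem_filter.1 hu).1))
    linarith [hf.2.1]
  · have := add_le_sum_of_nonneg (f := f) (A := G.filter (fun u => ρ - Δ ≤ u ∧ u < ρ))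
      (mem_filter.2 ⟨hv, by linarith, h⟩)
      (mem_filter.2 ⟨hw, h', lt_of_le_of_ne h'' hwρ⟩) hvw
      (fun u hu => nonneg_of_binary (hf.1 u (mem_filter.1 hu).1))
    linarith [hf.2.2.1]

lemma replaceUse_self (hf : f v = 0 ∨ f v = 1) (hρ : f v = 1 → v ≠ ρ) :
    replaceUse v w ρ f v = 0 := by
  unfold replaceUse
  rcases hf with h | h
  · simp [h]
  · simp [h, hρ h]

lemma replaceUse_le (hf : Selects G ρ Δ f) {u : ℝ} (hu : u ∈ G) (huw : u ≠ w) :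
    replaceUse v w ρ f u ≤ f u := by
  have h0 := nonneg_of_binary (hf.1 u hu)
  unfold replaceUse
  split_ifs <;> first | linarith | simp_all

lemma replaceUse_target_le (hf : Selects G ρ Δ f) (hv : v ∈ G) (hw : w ∈ G) :
    replaceUse v w ρ f w ≤ f v + f w := by
  have h0 := nonneg_of_binary (hf.1 w hw)
  have h1 := nonneg_of_binary (hf.1 v hv)
  unfold replaceUse
  split_ifs <;> linarith

lemma le_replaceUse_request (hf : Selects G ρ Δ f) (hρ : ρ ∈ G) (hvρ : f v = 1 → v ≠ ρ) :
    f ρ ≤ replaceUse v w ρ f ρ := by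
  have := le_one_of_binary (hf.1 ρ hρ)
  unfold replaceUse
  split_ifs <;> first | linarith | simp_all

lemma replaceUse_request_eq_one (h1 : f v = 1) : replaceUse v ρ ρ f ρ = 1 := by
  simp [replaceUse, h1]

lemma Selects.replaceUse (hf : Selects G ρ Δ f) (hΔ : 0 ≤ Δ) (hρ : ρ ∈ G) (hv : v ∈ G)
    (hw : w ∈ G) (hvw : v ≠ w) (hrep : f v = 1 → Replaceable Δ v w ρ) :
    Selects G ρ Δ (replaceUse v w ρ f) := by
  by_cases h1 : f v = 1
  swap
  · have : _root_.replaceUse v w ρ f = f := by funext u; simp [_root_.replaceUse, h1]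
    rwa [this]
  have hrep := hrep h1
  have habs := abs_le.1 (hf.abs_sub_le hv h1)
  have hw0 := hf.replacement_eq_zero hρ hv hw hvw h1 hrep
  rcases eq_or_ne w ρ with rfl | hwρ
  · have hval : ∀ u, _root_.replaceUse v w w f u = if u = w then 1 else 0 := fun u => by
      simp [_root_.replaceUse, h1]
    refine ⟨fun u _ => ?_, ?_, ?_, fun u _ hu => ?_⟩
    · rw [hval]; split_ifs <;> simp
    · rw [hval, if_pos rfl, sum_eq_zero, add_zero]
      intro u hu
      rw [hval, if_neg (mem_filter.1 hu).2.1.ne']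
    · rw [hval, if_pos rfl, sum_eq_zero, add_zero]
      intro u hu
      rw [hval, if_neg (mem_filter.1 hu).2.2.ne]
    · rw [hval, if_neg]
      rintro rfl
      simp at hu
      linarith
  · have hval : ∀ u, _root_.replaceUse v w ρ f u = if u = v then 0 else if u = w then 1 else f u :=
      fun u => by simp [_root_.replaceUse, h1, hwρ]
    have hvρ : v ≠ ρ := by
      rcases hrep with h | h
      · exact h.1.ne'
      · exact h.1.ne
    have hρval : _root_.replaceUse v w ρ f ρ = f ρ := by
      rw [hval, if_neg hvρ.symm, if_neg hwρ.symm]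
    have hmoved : ∀ A : Finset ℝ, v ∈ A → w ∈ A →
        ∑ u ∈ A, _root_.replaceUse v w ρ f u = ∑ u ∈ A, f u := fun A hvA hwA =>
      sum_merge hvA hwA hvw (by simp [hval]) (by simp [hval, hvw.symm, h1, hw0])
        fun u huv huw => by simp [hval, huv, huw]
    have hfixed : ∀ A : Finset ℝ, v ∉ A → w ∉ A →
        ∑ u ∈ A, _root_.replaceUse v w ρ f u = ∑ u ∈ A, f u := fun A hvA hwA =>
      sum_congr rfl fun u hu => by
        rw [hval, if_neg (by rintro rfl; exact hvA hu), if_neg (by rintro rfl; exact hwA hu)]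
    refine ⟨fun u hu => ?_, ?_, ?_, fun u hu hlt => ?_⟩
    · rw [hval]
      split_ifs
      · simp
      · simp
      · exact hf.1 u hu
    · rw [hρval]
      refine Eq.trans ?_ hf.2.1
      congr 1
      rcases hrep with ⟨h, h', h''⟩ | ⟨h, h', h''⟩
      · exact hmoved _ (mem_filter.2 ⟨hv, h, by linarith⟩)
          (mem_filter.2 ⟨hw, lt_of_le_of_ne h' hwρ.symm, h''⟩)
      · exact hfixed _ (fun hm => absurd (mem_filter.1 hm).2.1 (by linarith))
          (fun hm => absurd (mem_filter.1 hm).2.1 (by linarith))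
    · rw [hρval]
      refine Eq.trans ?_ hf.2.2.1
      congr 1
      rcases hrep with ⟨h, h', h''⟩ | ⟨h, h', h''⟩
      · exact hfixed _ (fun hm => absurd (mem_filter.1 hm).2.2 (by linarith))
          (fun hm => absurd (mem_filter.1 hm).2.2 (by linarith))
      · exact hmoved _ (mem_filter.2 ⟨hv, by linarith, h⟩)
          (mem_filter.2 ⟨hw, h', lt_of_le_of_ne h'' hwρ⟩)
    · rw [hval]
      split_ifs with huv huw
      · rfl
      · subst huw
        exfalso
        refine absurd hlt (not_lt.2 (abs_le.2 ?_))
        rcases hrep with h | h <;> constructor <;> linarith [h.1, h.2.1, h.2.2]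
      · exact hf.2.2.2 u hu hlt

end replaceUse

lemma P1Feasible.selects {V Q : ℕ} [Fintype K] [Fintype S] {q : S → ℝ} {ch : S → K → ℝ}
    {B T R n0 : ℝ} {r Δ : K → ℝ} {x : ℝ → ℝ} {y : K → ℝ → ℝ} {t p : S → ℝ → ℝ}
    (h : P1Feasible V Q q ch B T R n0 r Δ x y t p) (k : K) :
    Selects (Vbar V Q) (r k) (Δ k) (y k) :=
  ⟨h.2.1 k, h.2.2.1 k, h.2.2.2.1 k, h.2.2.2.2.1 k⟩

open Classical in
/-- The transmission variables after replacing the view `v` by `w`. -/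
def replaceSend (v w : ℝ) (x : ℝ → ℝ) (u : ℝ) : ℝ := if u = v then 0 else if u = w then 1 else x u

open Classical in
/-- The time allocation after merging the view `v` into `w`. -/
def mergeTime (v w : ℝ) (t : S → ℝ → ℝ) (s : S) (u : ℝ) : ℝ :=
  if u = v then 0 else if u = w then t s v + t s w else t s u

open Classical in
/-- The power allocation after merging the view `v` into `w`. -/
def mergePower (v w : ℝ) (t p : S → ℝ → ℝ) (s : S) (u : ℝ) : ℝ :=
  if u = w then mergedPower (t s v) (p s v) (t s w) (p s w) else p s u

section replacement

variable {V Q : ℕ} [Fintype K] [Fintype S] {q : S → ℝ} {ch : S → K → ℝ} {B T R n0 : ℝ}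
  {r : K → ℝ} {Δ : ℝ} {x : ℝ → ℝ} {y : K → ℝ → ℝ} {t p : S → ℝ → ℝ} {v w : ℝ}

/-- Replacing `v` by an admissible `w` preserves feasibility. -/
lemma P1Feasible.replace (h : P1Feasible V Q q ch B T R n0 r (fun _ => Δ) x y t p)
    (hq : ∀ s, 0 < q s) (hch : ∀ s k, 0 < ch s k) (hB : 0 < B) (hT : 0 < T) (hR : 0 < R)
    (hn0 : 0 < n0) (hΔ : 0 ≤ Δ) (hr : ∀ k, r k ∈ Vbar V Q) (hv : v ∈ Vbar V Q)
    (hw : w ∈ Vbar V Q) (hvw : v ≠ w) (hrep : ∀ k, y k v = 1 → Replaceable Δ v w (r k)) :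
    P1Feasible V Q q ch B T R n0 r (fun _ => Δ) (replaceSend v w x)
      (fun k => replaceUse v w (r k) (y k)) (mergeTime v w t) (mergePower v w t p) := by
  have hsel := fun k => (h.selects k).replaceUse hΔ (hr k) hv hw hvw (hrep k)
  have hvr : ∀ k, y k v = 1 → v ≠ r k := fun k hk => by
    rcases hrep k hk with h | h
    · exact h.1.ne'
    · exact h.1.ne
  have hself : ∀ k, replaceUse v w (r k) (y k) v = 0 := fun k =>
    replaceUse_self (h.2.1 k v hv) (hvr k)
  have hselects := fun k => h.selects k
  obtain ⟨hx, -, -, -, -, hyx, ht, htT, hp, hrate⟩ := h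
  have ht' : ∀ s, ∀ u ∈ Vbar V Q, 0 ≤ mergeTime v w t s u := fun s u hu => by
    unfold mergeTime
    split_ifs
    · exact le_rfl
    · exact add_nonneg (ht s v hv) (ht s w hw)
    · exact ht s u hu
  have hp' : ∀ s, ∀ u ∈ Vbar V Q, 0 ≤ mergePower v w t p s u := fun s u hu => by
    unfold mergePower
    split_ifs
    · exact mergedPower_nonneg (ht s v hv) (ht s w hw) (hp s v hv) (hp s w hw)
    · exact hp s u hu
  refine ⟨fun u hu => ?_, fun k => (hsel k).1, fun k => (hsel k).2.1, fun k => (hsel k).2.2.1,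
    fun k => (hsel k).2.2.2, fun k u hu => ?_, ht', fun s => ?_, hp', fun k u hu => ?_⟩
  · unfold replaceSend
    split_ifs
    · simp
    · simp
    · exact hx u hu
  · unfold replaceSend
    split_ifs with huv huw
    · subst huv
      exact (hself k).le
    · exact le_one_of_binary ((hsel k).1 u hu)
    · exact (replaceUse_le (hselects k) hu huw).trans (hyx k u hu)
  · rw [sum_merge (f := t s) hv hw hvw (by simp [mergeTime]) (by simp [mergeTime, hvw.symm])
      fun u huv huw => by simp [mergeTime, huv, huw]]
    exact htT s
  · have hBT : 0 ≤ B / T := by positivity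
    by_cases huv : u = v
    · subst huv
      simp only [hself, zero_mul]
      exact mul_nonneg hBT (sum_nonneg fun s _ => mul_nonneg (hq s).le
        (rate_nonneg (ht' s u hu) (hp' s u hu) (hch s k).le hn0.le))
    by_cases huw : u = w
    · subst huw
      calc replaceUse v u (r k) (y k) u * R ≤ (y k v + y k u) * R :=
            mul_le_mul_of_nonneg_right (replaceUse_target_le (hselects k) hv hu) hR.le
        _ = y k v * R + y k u * R := add_mul _ _ _
        _ ≤ _ := add_le_add (hrate k v hv) (hrate k u hu)
        _ ≤ _ := by
          rw [← mul_add, ← sum_add_distrib]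
          refine mul_le_mul_of_nonneg_left (sum_le_sum fun s _ => ?_) hBT
          rw [← mul_add]
          refine mul_le_mul_of_nonneg_left ?_ (hq s).le
          simpa [mergeTime, mergePower, hvw.symm] using
            rate_add_le_rate_merged (ht s v hv) (ht s u hu) (hp s v hv) (hp s u hu)
              (hch s k).le hn0.le
    · refine (mul_le_mul_of_nonneg_right (replaceUse_le (hselects k) hu huw) hR.le).trans
        ((hrate k u hu).trans_eq ?_)
      simp [mergeTime, mergePower, huv, huw]

/-- Replacing `v` by an admissible `w` does not increase the objective, provided that `v` has to be
synthesized anyway or that some user of `v` requests `w`. -/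
lemma Eobj_replace_le {Eb : ℝ} {Eu : K → ℝ} {β : ℝ}
    (h : P1Feasible V Q q ch B T R n0 r (fun _ => Δ) x y t p)
    (hEb : 0 ≤ Eb) (hEu : ∀ k, 0 ≤ Eu k) (hβ : 1 ≤ β) (hβEu : ∀ k, Eb ≤ β * Eu k)
    (hr : ∀ k, r k ∈ Vbar V Q) (hv : v ∈ Vbar V Q)
    (hw : w ∈ Vbar V Q) (hvw : v ≠ w) (hrep : ∀ k, y k v = 1 → Replaceable Δ v w (r k))
    (hused : ∃ k, y k v = 1) (hcost : v ∉ Vorig V ∨ ∃ k, y k v = 1 ∧ r k = w) :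
    Eobj V Q q Eb Eu β r (replaceSend v w x) (fun k => replaceUse v w (r k) (y k))
      (mergeTime v w t) (mergePower v w t p) ≤ Eobj V Q q Eb Eu β r x y t p := by
  have hvr : ∀ k, y k v = 1 → v ≠ r k := fun k hk => by
    rcases hrep k hk with h | h
    · exact h.1.ne'
    · exact h.1.ne
  have hselects := fun k => h.selects k
  obtain ⟨hx, -, -, -, -, hyx, ht, -, -, -⟩ := h
  have hxv : x v = 1 := by
    obtain ⟨k, hk⟩ := hused
    have := hyx k v hv
    have := le_one_of_binary (hx v hv)
    linarith
  have henergy : (∑ s : S, q s * ∑ u ∈ Vbar V Q, mergeTime v w t s u * mergePower v w t p s u)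
      = ∑ s : S, q s * ∑ u ∈ Vbar V Q, t s u * p s u := by
    refine sum_congr rfl fun s _ => ?_
    congr 1
    refine sum_merge (f := fun u => t s u * p s u) hv hw hvw (by simp [mergeTime]) ?_
      fun u huv huw => by simp [mergeTime, mergePower, huv, huw]
    simpa [mergeTime, mergePower, hvw.symm] using
      add_mul_mergedPower (p s v) (p s w) (ht s v hv) (ht s w hw)
  set N := Vbar V Q \ Vorig V with hN
  have hsend : ∑ u ∈ N, replaceSend v w x u ≤
      ∑ u ∈ N, x u + (if w ∈ N then 1 else 0) - (if v ∈ N then 1 else 0) := by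
    have : ∀ u ∈ N, replaceSend v w x u ≤
        x u + (if w = u then 1 else 0) - (if v = u then 1 else 0) := fun u hu => by
      have h0 := nonneg_of_binary (hx u (mem_sdiff.1 hu).1)
      unfold replaceSend
      by_cases huv : u = v
      · subst huv; simp [hxv, hvw.symm]
      by_cases huw : u = w
      · subst huw; simp [huv, hvw, h0]
      · simp [huv, huw, Ne.symm huv, Ne.symm huw]
    refine (sum_le_sum this).trans_eq ?_
    rw [sum_sub_distrib, sum_add_distrib, sum_ite_eq, sum_ite_eq]
  have hmono : ∀ k, (1 - replaceUse v w (r k) (y k) (r k)) * Eu k ≤ (1 - y k (r k)) * Eu k :=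
    fun k => mul_le_mul_of_nonneg_right
      (sub_le_sub_left (le_replaceUse_request (hselects k) (hr k) (hvr k)) 1) (hEu k)
  have hβ0 : 0 ≤ β := by linarith
  have hw1 : (if w ∈ N then (1 : ℝ) else 0) ≤ 1 := by split_ifs <;> norm_num
  simp only [Eobj, ← hN, henergy]
  by_cases hvo : v ∈ Vorig V
  · obtain ⟨k, hk, rfl⟩ := hcost.resolve_left (not_not.2 hvo)
    have hvN : v ∉ N := fun hm => (mem_sdiff.1 hm).2 hvo
    rw [if_neg hvN] at hsend
    have hyk : y k (r k) = 0 :=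
      ((hselects k).request_eq_zero hv hk hvw).resolve_right (not_not.2 (hr k))
    have hsynth : (∑ i, (1 - replaceUse v (r k) (r i) (y i) (r i)) * Eu i) + Eu k
        ≤ ∑ i, (1 - y i (r i)) * Eu i := by
      classical
      rw [← add_sum_erase univ _ (mem_univ k), ← add_sum_erase univ (fun i => (1 - y i (r i)) * Eu i)
        (mem_univ k), replaceUse_request_eq_one hk, hyk]
      have := sum_le_sum (s := univ.erase k) fun i _ => hmono i
      linarith
    have h1 := mul_le_mul_of_nonneg_left hsynth hβ0
    have h2 := mul_le_mul_of_nonneg_left (hsend.trans (show _ ≤ ∑ u ∈ N, x u + 1 by linarith)) hEb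
    have := hβEu k
    linarith
  · rw [if_pos (mem_sdiff.2 ⟨hv, hvo⟩)] at hsend
    have h1 := mul_le_mul_of_nonneg_left (sum_le_sum fun i (_ : i ∈ univ) => hmono i) hβ0
    have h2 := mul_le_mul_of_nonneg_left (hsend.trans (show _ ≤ ∑ u ∈ N, x u by linarith)) hEb
    linarith

end replacement

lemma self_mem_Uab (V Q : ℕ) (Δ a b : ℝ) : a ∈ Uab V Q Δ a b := by
  unfold Uab
  dsimp only
  split_ifs <;> simp

lemma request_mem_iUnion_Uset {V Q : ℕ} [Fintype K] (hK : 2 ≤ Fintype.card K) (Δ : ℝ)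
    (r : K → ℝ) (k : K) : r k ∈ ⋃ k' : K, Uset V Q Δ r k' := by
  have : Nontrivial K := Fintype.one_lt_card_iff_nontrivial.1 hK
  obtain ⟨i, hi⟩ := exists_ne k
  exact Set.mem_iUnion.2 ⟨k, Set.mem_iUnion₂.2 ⟨i, hi, self_mem_Uab V Q Δ _ _⟩⟩

lemma Uab_eq_of_far {V Q : ℕ} {Δ a b v : ℝ} (hv : v ∈ Vbar V Q) (hav : a < v) (hva : v ≤ a + Δ)
    (hbv : b - Δ ≤ v) (hvb : v < b) (hab : a + Δ < b) :
    Uab V Q Δ a b = {a, b - Δ, a + Δ} ∪ (({u | u ∈ Vbar V Q ∧ a < u ∧ u ≤ a + Δ} ∩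
      {u | u ∈ Vbar V Q ∧ b - Δ ≤ u ∧ u < b}) ∩ {u | u ∈ Vorig V}) := by
  have hle : a ≤ b := (hav.trans hvb).le
  unfold Uab
  simp only [max_eq_right hle, min_eq_left hle]
  rw [if_neg, if_pos]
  · exact fun hm => absurd hm.2.2 (not_le.2 hab)
  · exact Set.Nonempty.ne_empty ⟨v, ⟨hv, hav, hva⟩, hv, hbv, hvb⟩

lemma sub_mem_Vbar {V Q : ℕ} (hQ : 0 < Q) {a Δ : ℝ} (ha : a ∈ Vbar V Q) (hΔ : Δ ∈ Dset V Q)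
    (h : 1 ≤ a - Δ) : a - Δ ∈ Vbar V Q := by
  simp only [Vbar, Dset, mem_image, mem_range] at *
  obtain ⟨n, hn, rfl⟩ := ha
  obtain ⟨m, -, rfl⟩ := hΔ
  have hQ' : (0 : ℝ) < Q := by exact_mod_cast hQ
  have hle : m + Q ≤ n := by
    have h' : ((m : ℝ) + Q) / Q ≤ n / Q := by
      rw [add_div, div_self hQ'.ne']; linarith
    exact_mod_cast (div_le_div_iff_of_pos_right hQ').1 h'
  refine ⟨n - (m + Q), by omega, ?_⟩
  rw [Nat.cast_sub hle]
  push_cast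
  field_simp
  ring

lemma one_le_of_mem_Vbar {V Q : ℕ} {a : ℝ} (ha : a ∈ Vbar V Q) : 1 ≤ a := by
  obtain ⟨n, -, rfl⟩ := mem_image.1 ha
  exact le_add_of_nonneg_right (by positivity)

lemma one_le_of_mem_Dset {V Q : ℕ} {a : ℝ} (ha : a ∈ Dset V Q) : 1 ≤ a := by
  obtain ⟨n, -, rfl⟩ := mem_image.1 ha
  exact le_add_of_nonneg_right (by positivity)

/-- A view outside `⋃ k, U_k` shared by a nonempty set of users can be replaced, at no extra
synthesis cost, by a view inside. -/
lemma exists_replacement {V Q : ℕ} [Fintype K] (hQ : 0 < Q) (hK : 2 ≤ Fintype.card K)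
    {r : K → ℝ} (hr : ∀ k, r k ∈ Vbar V Q) {Δ : ℝ} (hΔ : Δ ∈ Dset V Q) {v : ℝ}
    (hv : v ∈ Vbar V Q) (hvU : v ∉ ⋃ k' : K, Uset V Q Δ r k') {A : Finset K} (hA : A.Nonempty)
    (hnear : ∀ k ∈ A, |v - r k| ≤ Δ) :
    ∃ w ∈ Vbar V Q, w ∈ (⋃ k' : K, Uset V Q Δ r k') ∧ (∀ k ∈ A, Replaceable Δ v w (r k)) ∧
      (v ∉ Vorig V ∨ ∃ k ∈ A, r k = w) := by
  have hne : ∀ k, r k ≠ v := fun k hk => hvU (hk ▸ request_mem_iUnion_Uset hK Δ r k)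
  have hbd := fun k hk => abs_le.1 (hnear k hk)
  by_cases hR : (A.filter fun k => r k < v).Nonempty
  swap
  · obtain ⟨b, hbA, hb⟩ := exists_min_image A r hA
    refine ⟨r b, hr b, request_mem_iUnion_Uset hK Δ r b, fun k hk => Or.inr ?_,
      Or.inr ⟨b, hbA, rfl⟩⟩
    have hgt : ∀ k ∈ A, v < r k := fun k hk => lt_of_le_of_ne
      (not_lt.1 fun h => hR ⟨k, mem_filter.2 ⟨hk, h⟩⟩) (hne k).symm
    exact ⟨hgt k hk, by linarith [hgt b hbA, hbd k hk], hb k hk⟩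
  obtain ⟨a, ha, hmax⟩ := exists_max_image _ r hR
  obtain ⟨haA, hav⟩ := mem_filter.1 ha
  by_cases hL : (A.filter fun k => r a < r k - Δ).Nonempty
  swap
  · refine ⟨r a, hr a, request_mem_iUnion_Uset hK Δ r a, fun k hk => ?_, Or.inr ⟨a, haA, rfl⟩⟩
    rcases lt_or_gt_of_ne (hne k) with h | h
    · exact Or.inl ⟨h, hmax k (mem_filter.2 ⟨hk, h⟩), by linarith [hbd k hk]⟩
    · exact Or.inr ⟨h, not_lt.1 fun h' => hL ⟨k, mem_filter.2 ⟨hk, h'⟩⟩, (hav.trans h).le⟩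
  obtain ⟨j, hj, hjmax⟩ := exists_max_image _ r hL
  obtain ⟨hjA, haj⟩ := mem_filter.1 hj
  have hΔ1 := one_le_of_mem_Dset hΔ
  have hjv : v < r j := by linarith [hbd a haA]
  have hja : j ≠ a := by rintro rfl; exact absurd hav (not_lt.2 hjv.le)
  have hU := Uab_eq_of_far (Δ := Δ) hv hav (by linarith [hbd a haA]) (by linarith [hbd j hjA]) hjv
    (by linarith)
  have hsub : ∀ u ∈ Uab V Q Δ (r a) (r j), u ∈ ⋃ k' : K, Uset V Q Δ r k' := fun u hu =>
    Set.mem_iUnion.2 ⟨a, Set.mem_iUnion₂.2 ⟨j, hja, hu⟩⟩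
  refine ⟨r j - Δ, sub_mem_Vbar hQ (hr j) hΔ (by linarith [one_le_of_mem_Vbar (hr a)]),
    hsub _ (by rw [hU]; simp), fun k hk => ?_, Or.inl fun hvo => hvU (hsub v ?_)⟩
  · rcases lt_or_gt_of_ne (hne k) with h | h
    · have := hmax k (mem_filter.2 ⟨hk, h⟩)
      exact Or.inl ⟨h, by linarith, by linarith [hbd k hk, hbd j hjA]⟩
    · refine Or.inr ⟨h, ?_, by linarith [hbd j hjA]⟩
      by_cases hk' : r a < r k - Δ
      · linarith [hjmax k (mem_filter.2 ⟨hk, hk'⟩)]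
      · linarith
  · rw [hU]
    exact Or.inr ⟨⟨⟨hv, hav, by linarith [hbd a haA]⟩, hv, by linarith [hbd j hjA], hjv⟩, hvo⟩

/-- if all users share the same quality `Δ`, `|K| ≥ 2` and
`β·E_{u,k} ≥ E_b` for every `k`, then whenever Problem 1 admits an optimal solution it
admits one in which no user utilizes any view outside `∪_{k∈K} U_k`. -/
theorem no_view_outside_U_utilized (V Q : ℕ) (hV : 2 ≤ V) (hQ : 2 ≤ Q)
    [Fintype K] [Fintype S] [Nonempty S]
    (hK : 2 ≤ Fintype.card K)
    (q : S → ℝ) (hq : ∀ s, 0 < q s) (hqsum : ∑ s, q s = 1)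
    (ch : S → K → ℝ) (hch : ∀ s k, 0 < ch s k)
    (B T R n0 : ℝ) (hB : 0 < B) (hT : 0 < T) (hR : 0 < R) (hn0 : 0 < n0)
    (Eb : ℝ) (hEb : 0 ≤ Eb) (Eu : K → ℝ) (hEu : ∀ k, 0 ≤ Eu k)
    (β : ℝ) (hβ : 1 ≤ β) (hβEu : ∀ k, Eb ≤ β * Eu k)
    (r : K → ℝ) (hr : ∀ k, r k ∈ Vbar V Q)
    (Δc : ℝ) (hΔc : Δc ∈ Dset V Q) :
    (∃ (x : ℝ → ℝ) (y : K → ℝ → ℝ) (t p : S → ℝ → ℝ),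
        P1Optimal V Q q ch B T R n0 Eb Eu β r (fun _ => Δc) x y t p) →
    ∃ (x : ℝ → ℝ) (y : K → ℝ → ℝ) (t p : S → ℝ → ℝ),
      P1Optimal V Q q ch B T R n0 Eb Eu β r (fun _ => Δc) x y t p ∧
      ∀ (k : K), ∀ v ∈ Vbar V Q,
        v ∉ (⋃ k' : K, Uset V Q Δc r k') → y k v = 0 := by
  classical
  rintro ⟨x, y, t, p, hopt⟩
  set W := ⋃ k' : K, Uset V Q Δc r k'
  induction hn : #((Vbar V Q).filter fun u => u ∉ W ∧ ∃ k, y k u ≠ 0) using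
    Nat.strong_induction_on generalizing x y t p with
  | _ n ih =>
  by_cases hgood : ∀ k, ∀ v ∈ Vbar V Q, v ∉ W → y k v = 0
  · exact ⟨x, y, t, p, hopt, hgood⟩
  push Not at hgood
  obtain ⟨k₀, v, hv, hvW, hk₀⟩ := hgood
  have hfeas := hopt.1
  have hk₀1 : y k₀ v = 1 := (hfeas.2.1 k₀ v hv).resolve_left hk₀
  obtain ⟨w, hw, hwW, hrep, hcost⟩ := exists_replacement (by omega : 0 < Q) hK hr hΔc hv hvW
    (A := univ.filter fun k => y k v = 1) ⟨k₀, by simp [hk₀1]⟩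
    fun k hk => (hfeas.selects k).abs_sub_le hv (mem_filter.1 hk).2
  simp only [mem_filter, mem_univ, true_and] at hrep hcost
  have hvw : v ≠ w := fun h => hvW (h ▸ hwW)
  have hΔ0 : 0 ≤ Δc := zero_le_one.trans (one_le_of_mem_Dset hΔc)
  have hfeas' := hfeas.replace hq hch hB hT hR hn0 hΔ0 hr hv hw hvw hrep
  have hobj := Eobj_replace_le hfeas hEb hEu hβ hβEu hr hv hw hvw hrep ⟨k₀, hk₀1⟩ hcost
  refine ih _ ?_ _ _ _ _ ⟨hfeas', fun x' y' t' p' h' => hobj.trans (hopt.2 x' y' t' p' h')⟩ rfl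
  rw [← hn]
  refine card_lt_card (ssubset_iff_of_subset ?_ |>.2 ⟨v, ?_, ?_⟩)
  · intro u hu
    obtain ⟨huG, huW, k, hk⟩ := mem_filter.1 hu
    refine mem_filter.2 ⟨huG, huW, k, fun h0 => hk ?_⟩
    have huw : u ≠ w := fun h => huW (h ▸ hwW)
    exact le_antisymm ((replaceUse_le (hfeas.selects k) huG huw).trans_eq h0)
      (nonneg_of_binary (hfeas'.2.1 k u huG))
  · exact mem_filter.2 ⟨hv, hvW, k₀, hk₀⟩
  · rintro hm
    obtain ⟨-, -, k, hk⟩ := mem_filter.1 hm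
    exact hk (replaceUse_self (hfeas.2.1 k v hv) fun _ h =>
      hvW (h ▸ request_mem_iUnion_Uset hK Δc r k))
end
end

section
/- If (x, y, t, p, Δ) is feasible for Problem 8 (the continuous relaxation of Problem 7 in which each Δ_k is only required to lie in the interval [1, V−1]), then, setting Δ'_k = max{ d ∈ {1, 1+1/Q, …, V−1} : d ≤ Δ_k } for each k, the point (x, y, t, p, Δ') is feasible for Problem 7 and U(Δ') ≥ U(Δ). Consequently, Problem 7 and Problem 8 have the same optimal value, and (since each U_k is strictly decreasing) every optimal solution of Problem 8 has Δ_k ∈ {1, 1+1/Q, …, V−1} for all k, hence is an optimal solution of Problem 7. -/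
noncomputable section

open Finset

variable {K S : Type*}

/-- The common constraints of Problems 7 and 8 (everything except the requirement on
the quality variables `Δ`): binary `x, y` satisfying the view-selection constraints,
`x ≥ y`, nonnegative time/power allocation with per-state time budgets, the rate
constraints, the server energy budget and the per-user energy budgets. -/
def P7Core (V Q : ℕ) [Fintype K] [Fintype S]
    (q : S → ℝ) (ch : S → K → ℝ) (B T R n0 : ℝ)
    (Eb : ℝ) (Eu : K → ℝ) (Ebbar : ℝ) (Eubar : K → ℝ) (r : K → ℝ)
    (x : ℝ → ℝ) (y : K → ℝ → ℝ) (t p : S → ℝ → ℝ) (Δ : K → ℝ) : Prop :=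
  (∀ v ∈ Vbar V Q, x v = 0 ∨ x v = 1) ∧
  (∀ k : K, ∀ v ∈ Vbar V Q, y k v = 0 ∨ y k v = 1) ∧
  (∀ k : K, y k (r k) +
      ∑ v ∈ (Vbar V Q).filter (fun v => r k < v ∧ v ≤ r k + Δ k), y k v = 1) ∧
  (∀ k : K, y k (r k) +
      ∑ v ∈ (Vbar V Q).filter (fun v => r k - Δ k ≤ v ∧ v < r k), y k v = 1) ∧
  (∀ k : K, ∀ v ∈ Vbar V Q, Δ k < |v - r k| → y k v = 0) ∧
  (∀ k : K, ∀ v ∈ Vbar V Q, y k v ≤ x v) ∧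
  (∀ s : S, ∀ v ∈ Vbar V Q, 0 ≤ t s v) ∧
  (∀ s : S, ∑ v ∈ Vbar V Q, t s v ≤ T) ∧
  (∀ s : S, ∀ v ∈ Vbar V Q, 0 ≤ p s v) ∧
  (∀ k : K, ∀ v ∈ Vbar V Q,
    y k v * R ≤ B / T * ∑ s : S, q s * (t s v * Real.logb 2 (1 + p s v * ch s k / n0))) ∧
  ((∑ s : S, q s * ∑ v ∈ Vbar V Q, t s v * p s v)
      + Eb * ∑ v ∈ Vbar V Q \ Vorig V, x v ≤ Ebbar) ∧
  (∀ k : K, (1 - y k (r k)) * Eu k ≤ Eubar k)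

/-- Feasibility for Problem 7 (total utility maximization): the common constraints
together with `Δ_k ∈ {1, 1+1/Q, …, V−1}`. -/
def P7Feasible (V Q : ℕ) [Fintype K] [Fintype S]
    (q : S → ℝ) (ch : S → K → ℝ) (B T R n0 : ℝ)
    (Eb : ℝ) (Eu : K → ℝ) (Ebbar : ℝ) (Eubar : K → ℝ) (r : K → ℝ)
    (x : ℝ → ℝ) (y : K → ℝ → ℝ) (t p : S → ℝ → ℝ) (Δ : K → ℝ) : Prop :=
  (∀ k : K, Δ k ∈ Dset V Q) ∧
  P7Core V Q q ch B T R n0 Eb Eu Ebbar Eubar r x y t p Δ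

/-- Feasibility for Problem 8 (the continuous relaxation of Problem 7): the common
constraints together with `1 ≤ Δ_k ≤ V − 1`. -/
def P8Feasible (V Q : ℕ) [Fintype K] [Fintype S]
    (q : S → ℝ) (ch : S → K → ℝ) (B T R n0 : ℝ)
    (Eb : ℝ) (Eu : K → ℝ) (Ebbar : ℝ) (Eubar : K → ℝ) (r : K → ℝ)
    (x : ℝ → ℝ) (y : K → ℝ → ℝ) (t p : S → ℝ → ℝ) (Δ : K → ℝ) : Prop :=
  (∀ k : K, 1 ≤ Δ k ∧ Δ k ≤ (V : ℝ) - 1) ∧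
  P7Core V Q q ch B T R n0 Eb Eu Ebbar Eubar r x y t p Δ

/-- Every point of the quality grid lies in `[1, V - 1]`. -/
theorem Dset_subset_Icc {V Q : ℕ} (hV : 2 ≤ V) (hQ : 0 < Q) {d : ℝ} (hd : d ∈ Dset V Q) :
    d ∈ Set.Icc (1 : ℝ) ((V : ℝ) - 1) := by
  obtain ⟨n, rfl⟩ := Nat.exists_eq_add_of_le' hV
  simp only [Dset, Finset.mem_image, Finset.mem_range] at hd
  obtain ⟨j, hj, rfl⟩ := hd
  have hQ' : (0 : ℝ) < Q := by exact_mod_cast hQ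
  have hj' : (j : ℝ) ≤ n * Q := by exact_mod_cast Nat.lt_succ_iff.mp hj
  have hle : (j : ℝ) / Q ≤ n := (div_le_iff₀ hQ').mpr hj'
  have hnonneg : (0 : ℝ) ≤ (j : ℝ) / Q := by positivity
  constructor
  · linarith
  · push_cast
    linarith

theorem one_mem_Dset (V Q : ℕ) : (1 : ℝ) ∈ Dset V Q := by
  simp only [Dset, Finset.mem_image, Finset.mem_range]
  exact ⟨0, by omega, by simp⟩

/-- The distance of two views, if at least `1`, lies on the quality grid. -/
theorem abs_sub_mem_Dset {V Q : ℕ} (hV : 2 ≤ V) (hQ : 0 < Q) {a b : ℝ}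
    (ha : a ∈ Vbar V Q) (hb : b ∈ Vbar V Q) (h : 1 ≤ |a - b|) : |a - b| ∈ Dset V Q := by
  wlog hab : b ≤ a generalizing a b
  · rw [abs_sub_comm] at h ⊢
    exact this hb ha h (le_of_not_ge hab)
  rw [abs_of_nonneg (sub_nonneg.mpr hab)] at h ⊢
  obtain ⟨n, rfl⟩ := Nat.exists_eq_add_of_le' hV
  simp only [Vbar, Finset.mem_image, Finset.mem_range] at ha hb
  obtain ⟨i, hi, rfl⟩ := ha
  obtain ⟨j, -, rfl⟩ := hb
  have hQ' : (0 : ℝ) < Q := by exact_mod_cast hQ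
  have hij : Q + j ≤ i := by
    have hdiff : 1 ≤ ((i : ℝ) - j) / Q := by
      rw [sub_div]
      linarith
    rw [le_div_iff₀ hQ'] at hdiff
    have hreal : (Q : ℝ) + j ≤ i := by linarith
    exact_mod_cast hreal
  obtain ⟨m, rfl⟩ := Nat.exists_eq_add_of_le hij
  simp only [Dset, Finset.mem_image, Finset.mem_range]
  refine ⟨m, ?_, ?_⟩
  · have hexp : (n + 2 - 1) * Q = n * Q + Q := by
      rw [show n + 2 - 1 = n + 1 by omega, add_mul, one_mul]
    rw [hexp] at hi
    rw [show n + 2 - 2 = n by omega]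
    omega
  · push_cast
    field_simp
    ring

/-- Every quality `d ≥ 1` can be rounded down to the quality grid. -/
theorem exists_Dset_floor (V Q : ℕ) {d : ℝ} (hd : 1 ≤ d) :
    ∃ d' ∈ Dset V Q, d' ≤ d ∧ ∀ e ∈ Dset V Q, e ≤ d → e ≤ d' := by
  obtain ⟨d', hd', hmax⟩ := ((Dset V Q).filter (· ≤ d)).exists_max_image id
    ⟨1, Finset.mem_filter.mpr ⟨one_mem_Dset V Q, hd⟩⟩
  rw [Finset.mem_filter] at hd'
  exact ⟨d', hd'.1, hd'.2, fun e he hed => hmax e (Finset.mem_filter.mpr ⟨he, hed⟩)⟩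

/-- The constraints depend on the qualities only through the comparisons of the distances
`|v - r k|` with `Δ k`. -/
theorem P7Core.congr_quality {V Q : ℕ} [Fintype K] [Fintype S]
    {q : S → ℝ} {ch : S → K → ℝ} {B T R n0 : ℝ}
    {Eb : ℝ} {Eu : K → ℝ} {Ebbar : ℝ} {Eubar : K → ℝ} {r : K → ℝ}
    {x : ℝ → ℝ} {y : K → ℝ → ℝ} {t p : S → ℝ → ℝ} {Δ Δ' : K → ℝ}
    (hΔ : ∀ k, ∀ v ∈ Vbar V Q, |v - r k| ≤ Δ k ↔ |v - r k| ≤ Δ' k)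
    (h : P7Core V Q q ch B T R n0 Eb Eu Ebbar Eubar r x y t p Δ) :
    P7Core V Q q ch B T R n0 Eb Eu Ebbar Eubar r x y t p Δ' := by
  obtain ⟨hx, hy, hright, hleft, hfar, hrest⟩ := h
  refine ⟨hx, hy, fun k => ?_, fun k => ?_, fun k v hv hlt => ?_, hrest⟩
  · rw [← hright k]
    congr 2
    refine Finset.filter_congr fun v hv => and_congr_right fun hlt => ?_
    have hcmp := hΔ k v hv
    rw [abs_of_pos (sub_pos.mpr hlt), sub_le_iff_le_add', sub_le_iff_le_add'] at hcmp
    exact hcmp.symm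
  · rw [← hleft k]
    congr 2
    refine Finset.filter_congr fun v hv => and_congr_left fun hlt => ?_
    have hcmp := hΔ k v hv
    rw [abs_sub_comm, abs_of_pos (sub_pos.mpr hlt), sub_le_comm, sub_le_comm (c := Δ' k)] at hcmp
    exact hcmp.symm
  · exact hfar k v hv (lt_of_not_ge fun hle => absurd ((hΔ k v hv).mp hle) (not_le.mpr hlt))

/-- Rounding the qualities down to the grid preserves feasibility. -/
theorem P8Feasible.round_down {V Q : ℕ} (hV : 2 ≤ V) (hQ : 0 < Q) [Fintype K] [Fintype S]
    {q : S → ℝ} {ch : S → K → ℝ} {B T R n0 : ℝ}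
    {Eb : ℝ} {Eu : K → ℝ} {Ebbar : ℝ} {Eubar : K → ℝ} {r : K → ℝ}
    (hr : ∀ k, r k ∈ Vbar V Q)
    {x : ℝ → ℝ} {y : K → ℝ → ℝ} {t p : S → ℝ → ℝ} {Δ Δ' : K → ℝ}
    (h : P8Feasible V Q q ch B T R n0 Eb Eu Ebbar Eubar r x y t p Δ)
    (hΔ' : ∀ k, Δ' k ∈ Dset V Q ∧ Δ' k ≤ Δ k ∧ ∀ d ∈ Dset V Q, d ≤ Δ k → d ≤ Δ' k) :
    P7Feasible V Q q ch B T R n0 Eb Eu Ebbar Eubar r x y t p Δ' := by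
  refine ⟨fun k => (hΔ' k).1, h.2.congr_quality fun k v hv => ⟨fun hle => ?_, fun hle => ?_⟩⟩
  · rcases le_total 1 |v - r k| with hge | hsmall
    · exact (hΔ' k).2.2 _ (abs_sub_mem_Dset hV hQ hv (hr k) hge) hle
    · exact hsmall.trans (Dset_subset_Icc hV hQ (hΔ' k).1).1
  · exact hle.trans (hΔ' k).2.1

theorem P7Feasible.toP8Feasible {V Q : ℕ} (hV : 2 ≤ V) (hQ : 0 < Q) [Fintype K] [Fintype S]
    {q : S → ℝ} {ch : S → K → ℝ} {B T R n0 : ℝ}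
    {Eb : ℝ} {Eu : K → ℝ} {Ebbar : ℝ} {Eubar : K → ℝ} {r : K → ℝ}
    {x : ℝ → ℝ} {y : K → ℝ → ℝ} {t p : S → ℝ → ℝ} {Δ : K → ℝ}
    (h : P7Feasible V Q q ch B T R n0 Eb Eu Ebbar Eubar r x y t p Δ) :
    P8Feasible V Q q ch B T R n0 Eb Eu Ebbar Eubar r x y t p Δ :=
  ⟨fun k => Dset_subset_Icc hV hQ (h.1 k), h.2⟩

/-- rounding the qualities of a feasible point of Problem 8 down to the
quality grid yields a feasible point of Problem 7 with no smaller total utility;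
consequently Problems 7 and 8 have the same optimal value, and every optimal solution
of Problem 8 has grid-valued qualities and is an optimal solution of Problem 7. -/
theorem relaxation_is_exact (V Q : ℕ) (hV : 2 ≤ V) (hQ : 2 ≤ Q)
    [Fintype K] [Fintype S] [Nonempty K] [Nonempty S]
    (q : S → ℝ) (hq : ∀ s, 0 < q s) (hqsum : ∑ s, q s = 1)
    (ch : S → K → ℝ) (hch : ∀ s k, 0 < ch s k)
    (B T R n0 : ℝ) (hB : 0 < B) (hT : 0 < T) (hR : 0 < R) (hn0 : 0 < n0)
    (Eb : ℝ) (hEb : 0 ≤ Eb) (Eu : K → ℝ) (hEu : ∀ k, 0 ≤ Eu k)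
    (Ebbar : ℝ) (hEbbar : 0 < Ebbar) (Eubar : K → ℝ) (hEubar : ∀ k, 0 ≤ Eubar k)
    (r : K → ℝ) (hr : ∀ k, r k ∈ Vbar V Q)
    (U : K → ℝ → ℝ)
    (hUpos : ∀ k, ∀ d ∈ Set.Icc (1 : ℝ) ((V : ℝ) - 1), 0 ≤ U k d)
    (hUanti : ∀ k, StrictAntiOn (U k) (Set.Icc (1 : ℝ) ((V : ℝ) - 1)))
    (hUconc : ∀ k, ConcaveOn ℝ (Set.Icc (1 : ℝ) ((V : ℝ) - 1)) (U k)) :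
    (∀ (x : ℝ → ℝ) (y : K → ℝ → ℝ) (t p : S → ℝ → ℝ) (Δ Δ' : K → ℝ),
      P8Feasible V Q q ch B T R n0 Eb Eu Ebbar Eubar r x y t p Δ →
      (∀ k, Δ' k ∈ Dset V Q ∧ Δ' k ≤ Δ k ∧ ∀ d ∈ Dset V Q, d ≤ Δ k → d ≤ Δ' k) →
      P7Feasible V Q q ch B T R n0 Eb Eu Ebbar Eubar r x y t p Δ' ∧
      ∑ k : K, U k (Δ k) ≤ ∑ k : K, U k (Δ' k)) ∧
    (sSup {u : ℝ | ∃ (x : ℝ → ℝ) (y : K → ℝ → ℝ) (t p : S → ℝ → ℝ) (Δ : K → ℝ),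
        P7Feasible V Q q ch B T R n0 Eb Eu Ebbar Eubar r x y t p Δ ∧
        u = ∑ k : K, U k (Δ k)}
      = sSup {u : ℝ | ∃ (x : ℝ → ℝ) (y : K → ℝ → ℝ) (t p : S → ℝ → ℝ) (Δ : K → ℝ),
          P8Feasible V Q q ch B T R n0 Eb Eu Ebbar Eubar r x y t p Δ ∧
          u = ∑ k : K, U k (Δ k)}) ∧
    (∀ (x : ℝ → ℝ) (y : K → ℝ → ℝ) (t p : S → ℝ → ℝ) (Δ : K → ℝ),
      P8Feasible V Q q ch B T R n0 Eb Eu Ebbar Eubar r x y t p Δ →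
      (∀ (x' : ℝ → ℝ) (y' : K → ℝ → ℝ) (t' p' : S → ℝ → ℝ) (Δ'' : K → ℝ),
        P8Feasible V Q q ch B T R n0 Eb Eu Ebbar Eubar r x' y' t' p' Δ'' →
        ∑ k : K, U k (Δ'' k) ≤ ∑ k : K, U k (Δ k)) →
      (∀ k, Δ k ∈ Dset V Q) ∧
      (P7Feasible V Q q ch B T R n0 Eb Eu Ebbar Eubar r x y t p Δ ∧
       ∀ (x' : ℝ → ℝ) (y' : K → ℝ → ℝ) (t' p' : S → ℝ → ℝ) (Δ'' : K → ℝ),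
         P7Feasible V Q q ch B T R n0 Eb Eu Ebbar Eubar r x' y' t' p' Δ'' →
         ∑ k : K, U k (Δ'' k) ≤ ∑ k : K, U k (Δ k))) := by
  have hQ0 : 0 < Q := by omega
  have mono : ∀ (Δ Δ' : K → ℝ), (∀ k, 1 ≤ Δ k ∧ Δ k ≤ (V : ℝ) - 1) →
      (∀ k, Δ' k ∈ Dset V Q) → (∀ k, Δ' k ≤ Δ k) → ∀ k, U k (Δ k) ≤ U k (Δ' k) :=
    fun Δ Δ' hΔ hΔ' hle k =>
      (hUanti k).antitoneOn (Dset_subset_Icc hV hQ0 (hΔ' k)) (hΔ k) (hle k)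
  have round : ∀ Δ : K → ℝ, (∀ k, 1 ≤ Δ k ∧ Δ k ≤ (V : ℝ) - 1) → ∃ Δ' : K → ℝ, ∀ k,
      Δ' k ∈ Dset V Q ∧ Δ' k ≤ Δ k ∧ ∀ d ∈ Dset V Q, d ≤ Δ k → d ≤ Δ' k := by
    intro Δ hΔ
    choose Δ' hΔ' using fun k => exists_Dset_floor V Q (hΔ k).1
    exact ⟨Δ', hΔ'⟩
  refine ⟨?_, ?_, ?_⟩
  · intro x y t p Δ Δ' h hΔ'
    exact ⟨h.round_down hV hQ0 hr hΔ', Finset.sum_le_sum fun k _ =>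
      mono Δ Δ' h.1 (fun k => (hΔ' k).1) (fun k => (hΔ' k).2.1) k⟩
  · set A := {u : ℝ | ∃ (x : ℝ → ℝ) (y : K → ℝ → ℝ) (t p : S → ℝ → ℝ) (Δ : K → ℝ),
        P7Feasible V Q q ch B T R n0 Eb Eu Ebbar Eubar r x y t p Δ ∧
        u = ∑ k : K, U k (Δ k)}
    set C := {u : ℝ | ∃ (x : ℝ → ℝ) (y : K → ℝ → ℝ) (t p : S → ℝ → ℝ) (Δ : K → ℝ),
        P8Feasible V Q q ch B T R n0 Eb Eu Ebbar Eubar r x y t p Δ ∧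
        u = ∑ k : K, U k (Δ k)}
    have hAC : A ⊆ C := by
      rintro u ⟨x, y, t, p, Δ, h, rfl⟩
      exact ⟨x, y, t, p, Δ, h.toP8Feasible hV hQ0, rfl⟩
    have hCA : ∀ u ∈ C, ∃ w ∈ A, u ≤ w := by
      rintro u ⟨x, y, t, p, Δ, h, rfl⟩
      obtain ⟨Δ', hΔ'⟩ := round Δ h.1
      exact ⟨_, ⟨x, y, t, p, Δ', h.round_down hV hQ0 hr hΔ', rfl⟩, Finset.sum_le_sum fun k _ =>
        mono Δ Δ' h.1 (fun k => (hΔ' k).1) (fun k => (hΔ' k).2.1) k⟩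
    have hC : BddAbove C := by
      refine ⟨∑ k : K, U k 1, ?_⟩
      rintro u ⟨x, y, t, p, Δ, h, rfl⟩
      exact Finset.sum_le_sum fun k _ =>
        mono Δ (fun _ => 1) h.1 (fun _ => one_mem_Dset V Q) (fun k => (h.1 k).1) k
    rcases C.eq_empty_or_nonempty with hempty | ⟨c, hc⟩
    · rw [Set.subset_eq_empty hAC hempty, hempty]
    · obtain ⟨a, ha, -⟩ := hCA c hc
      refine le_antisymm (csSup_le_csSup hC ⟨a, ha⟩ hAC) (csSup_le ⟨c, hc⟩ fun u hu => ?_)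
      obtain ⟨w, hw, huw⟩ := hCA u hu
      exact huw.trans (le_csSup (hC.mono hAC) hw)
  · intro x y t p Δ h hopt
    have hgrid : ∀ k, Δ k ∈ Dset V Q := by
      intro k
      by_contra hk
      obtain ⟨Δ', hΔ'⟩ := round Δ h.1
      have hlt : Δ' k < Δ k :=
        lt_of_le_of_ne (hΔ' k).2.1 fun heq => hk (heq ▸ (hΔ' k).1)
      refine (hopt x y t p Δ'
        ((h.round_down hV hQ0 hr hΔ').toP8Feasible hV hQ0)).not_gt ?_
      exact Finset.sum_lt_sum
        (fun k _ => mono Δ Δ' h.1 (fun k => (hΔ' k).1) (fun k => (hΔ' k).2.1) k)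
        ⟨k, Finset.mem_univ k, hUanti k (Dset_subset_Icc hV hQ0 (hΔ' k).1) (h.1 k) hlt⟩
    exact ⟨hgrid, ⟨hgrid, h.2⟩, fun x' y' t' p' Δ'' h'' =>
      hopt x' y' t' p' Δ'' (h''.toP8Feasible hV hQ0)⟩
end
end

section
/- Let r ∈ V̄, let Δ be a real number with 1 ≤ Δ ≤ V−1, let c > V−2, and let y : V̄ → {0,1}. Then y satisfies the three constraints [ y_r + Σ_{v∈V̄: r < v ≤ r+Δ} y_v = 1; y_r + Σ_{v∈V̄: r−Δ ≤ v < r} y_v = 1; and y_v = 0 for every v ∈ V̄ with |v − r| > Δ ] if and only if y satisfies the four constraints [ y_r + Σ_{v∈V̄: v > r} y_v = 1; y_r + Σ_{v∈V̄: v < r} y_v = 1; and for every v ∈ V̄, v − r − Δ ≤ c·(1 − y_v) and r − v − Δ ≤ c·(1 − y_v) ]; that is, the constraint sets Y and Y' coincide. -/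
noncomputable section

theorem Vbar_bounds {V Q : ℕ} (hV : 1 ≤ V) (hQ : 0 < Q) {v : ℝ} (hv : v ∈ Vbar V Q) :
    1 ≤ v ∧ v ≤ V := by
  obtain ⟨j, hj, rfl⟩ := Finset.mem_image.1 hv
  have hQ' : (0 : ℝ) < Q := by exact_mod_cast hQ
  have hj' : (j : ℝ) ≤ ((V : ℝ) - 1) * Q := by
    have h : j ≤ (V - 1) * Q := Nat.lt_succ_iff.1 (Finset.mem_range.1 hj)
    calc (j : ℝ) ≤ (((V - 1) * Q : ℕ) : ℝ) := by exact_mod_cast h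
      _ = ((V : ℝ) - 1) * Q := by rw [Nat.cast_mul, Nat.cast_sub hV, Nat.cast_one]
  have h₁ : (j : ℝ) / Q ≤ (V : ℝ) - 1 := (div_le_iff₀ hQ').2 hj'
  have h₂ : (0 : ℝ) ≤ (j : ℝ) / Q := by positivity
  constructor <;> linarith

/-- For a binary `y`, vanishing outside the window of radius `Δ` is a pair of big-M bounds. -/
theorem forall_eq_zero_iff_forall_le_mul {s : Finset ℝ} {r Δ c : ℝ} {y : ℝ → ℝ}
    (hs : ∀ v ∈ s, |v - r| - Δ ≤ c) (hy : ∀ v ∈ s, y v = 0 ∨ y v = 1) :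
    (∀ v ∈ s, Δ < |v - r| → y v = 0) ↔
      ∀ v ∈ s, v - r - Δ ≤ c * (1 - y v) ∧ r - v - Δ ≤ c * (1 - y v) := by
  refine forall₂_congr fun v hv => ?_
  have hc := hs v hv
  rw [sub_le_iff_le_add, abs_le] at hc
  rw [lt_abs]
  rcases hy v hv with h | h
  · simp only [h, implies_true, true_iff]
    constructor <;> linarith
  · simp only [h, one_ne_zero, imp_false, not_or, not_lt]
    constructor <;> rintro ⟨h₁, h₂⟩ <;> constructor <;> linarith

/-- A function vanishing outside a window has the same sum with or without the window. -/
theorem sum_filter_window_eq {s : Finset ℝ} {p q : ℝ → Prop} [DecidablePred p] [DecidablePred q]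
    {y : ℝ → ℝ} (hpq : ∀ v, p v → q v) (hy : ∀ v ∈ s, q v → ¬ p v → y v = 0) :
    ∑ v ∈ s.filter p, y v = ∑ v ∈ s.filter q, y v := by
  refine Finset.sum_subset (Finset.monotone_filter_right s fun v _ => hpq v) fun v hv hv' => ?_
  rw [Finset.mem_filter] at hv hv'
  exact hy v hv.1 hv.2 fun h => hv' ⟨hv.1, h⟩

/-- for a binary `y : V̄ → {0,1}`, the constraint set `Y`
(the original window-sum constraints together with the vanishing constraint outside the
window of radius `Δ`) coincides with the constraint set `Y'` (the full-sum constraints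
together with the big-M constraints with constant `c > V − 2`). -/
theorem constraint_sets_coincide (V Q : ℕ) (hV : 2 ≤ V) (hQ : 2 ≤ Q)
    (r : ℝ) (hr : r ∈ Vbar V Q)
    (Δ c : ℝ) (hΔ1 : 1 ≤ Δ) (hΔ2 : Δ ≤ (V : ℝ) - 1) (hc : (V : ℝ) - 2 < c)
    (y : ℝ → ℝ) (hy : ∀ v ∈ Vbar V Q, y v = 0 ∨ y v = 1) :
    (y r + ∑ v ∈ (Vbar V Q).filter (fun v => r < v ∧ v ≤ r + Δ), y v = 1 ∧
     y r + ∑ v ∈ (Vbar V Q).filter (fun v => r - Δ ≤ v ∧ v < r), y v = 1 ∧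
     ∀ v ∈ Vbar V Q, Δ < |v - r| → y v = 0)
    ↔
    (y r + ∑ v ∈ (Vbar V Q).filter (fun v => r < v), y v = 1 ∧
     y r + ∑ v ∈ (Vbar V Q).filter (fun v => v < r), y v = 1 ∧
     ∀ v ∈ Vbar V Q, v - r - Δ ≤ c * (1 - y v) ∧ r - v - Δ ≤ c * (1 - y v)) := by
  have hM : ∀ v ∈ Vbar V Q, |v - r| - Δ ≤ c := fun v hv => by
    have hv' := Vbar_bounds (by omega) (by omega) hv
    have hr' := Vbar_bounds (by omega) (by omega) hr
    have h : |v - r| ≤ (V : ℝ) - 1 := abs_le.2 ⟨by linarith, by linarith⟩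
    linarith
  rw [← forall_eq_zero_iff_forall_le_mul hM hy, ← and_assoc, ← and_assoc]
  refine and_congr_left fun h => ?_
  rw [sum_filter_window_eq (p := fun v => r < v ∧ v ≤ r + Δ) (q := fun v => r < v)
      (fun v hv => hv.1) fun v hv h₁ h₂ => h v hv <| lt_abs.2 <| Or.inl <| by
        by_contra h₃
        exact h₂ ⟨h₁, by linarith⟩,
    sum_filter_window_eq (p := fun v => r - Δ ≤ v ∧ v < r) (q := fun v => v < r)
      (fun v hv => hv.2) fun v hv h₁ h₂ => h v hv <| lt_abs.2 <| Or.inr <| by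
        by_contra h₃
        exact h₂ ⟨by linarith, h₁⟩]
end
end

section
/- For every y : K×V̄ → {0,1}, Problem 3 is strictly feasible (Slater's condition holds): there exist t, e : S×V̄ → ℝ with t_{s,v} > 0 and e_{s,v} > 0 for all s ∈ S, v ∈ V̄, with Σ_{v∈V̄} t_{s,v} < T for every s ∈ S, and such that for all k ∈ K and v ∈ V̄ the rate constraint holds strictly: (B/T)·Σ_{s∈S} q_s·φ(t_{s,v}, e_{s,v}·h_{s,k}/n₀) > y_{k,v}·R. -/
noncomputable section

open Finset

variable {K Vb S : Type*}

/-- For a positive time `t`, the rate `φ(t, e·c/n)` grows without bound with the energy `e`. -/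
theorem tendsto_phi_atTop_s15 {t c n : ℝ} (ht : 0 < t) (hc : 0 < c) (hn : 0 < n) :
    Filter.Tendsto (fun e => phi t (e * c / n)) Filter.atTop Filter.atTop := by
  simp only [phi, if_neg ht.ne']
  refine Filter.Tendsto.const_mul_atTop ht
    ((Real.tendsto_logb_atTop one_lt_two).comp (Filter.tendsto_atTop_add_const_left _ _ ?_))
  exact ((Filter.tendsto_id.atTop_mul_const hc).atTop_div_const hn).atTop_div_const ht

/-- Slater's condition for Problem 3.  For every binary `y` there is a
strictly feasible point: `t, e > 0` componentwise, strict time budgets, and strict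
rate constraints. -/
theorem problem3_strictly_feasible
    [Fintype K] [Fintype Vb] [Fintype S] [Nonempty K] [Nonempty Vb] [Nonempty S]
    (q : S → ℝ) (hq : ∀ s, 0 < q s) (hqsum : ∑ s, q s = 1)
    (ch : S → K → ℝ) (hch : ∀ s k, 0 < ch s k)
    (B T R n0 : ℝ) (hB : 0 < B) (hT : 0 < T) (hR : 0 < R) (hn0 : 0 < n0)
    (y : K → Vb → ℝ) (hy : ∀ k v, y k v = 0 ∨ y k v = 1) :
    ∃ t e : S → Vb → ℝ,
      (∀ s v, 0 < t s v) ∧ (∀ s v, 0 < e s v) ∧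
      (∀ s, ∑ v, t s v < T) ∧
      (∀ k v, y k v * R < B / T * ∑ s, q s * phi (t s v) (e s v * ch s k / n0)) := by
  have hcard : (0 : ℝ) < Fintype.card Vb := by exact_mod_cast Fintype.card_pos
  have hτ : 0 < T / (2 * Fintype.card Vb) := by positivity
  have hrate : ∀ᶠ e in Filter.atTop, ∀ s k,
      T / B * R < phi (T / (2 * Fintype.card Vb)) (e * ch s k / n0) :=
    Filter.eventually_all.2 fun s => Filter.eventually_all.2 fun k =>
      (tendsto_phi_atTop_s15 hτ (hch s k) hn0).eventually_gt_atTop _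
  obtain ⟨e, he, hphi⟩ := ((Filter.eventually_gt_atTop (0 : ℝ)).and hrate).exists
  refine ⟨fun _ _ => T / (2 * Fintype.card Vb), fun _ _ => e, fun _ _ => hτ, fun _ _ => he,
    fun _ => ?_, fun k v => ?_⟩
  · have hsum : ∑ _v : Vb, T / (2 * (Fintype.card Vb : ℝ)) = T / 2 := by
      rw [Finset.sum_const, Finset.card_univ, nsmul_eq_mul]
      field_simp
    rw [hsum]
    exact half_lt_self hT
  · have hyR : y k v * R ≤ R := by rcases hy k v with h | h <;> simp [h, hR.le]
    calc y k v * R ≤ R := hyR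
      _ = B / T * ∑ s, q s * (T / B * R) := by
        rw [← Finset.sum_mul, hqsum]
        field_simp
      _ < _ := by
        refine mul_lt_mul_of_pos_left (Finset.sum_lt_sum_of_nonempty univ_nonempty fun s _ => ?_)
          (div_pos hB hT)
        exact mul_lt_mul_of_pos_left (hphi s k) (hq s)
end
end
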